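/- Let Ω ∈ K^n/ℤ^n. The isomorphism classes of simple (generalized) weight 𝕀_n-modules with support contained in Ω are exactly the modules M(𝒟_Ω) for the subsets 𝒟_Ω ⊆ 𝔻_Ω, and there are exactly 2^{|𝔻_Ω|} of them. Moreover: (1) M(𝒟_Ω) is a faithful 𝕀_n-module if and only if 𝒟_Ω = {1,…,n}; (2) if 𝒟_Ω ≠ {1,…,n} then ann_{𝕀_n}(M(𝒟_Ω)) = 𝔞_n(𝒩_Ω) where 𝒩_Ω = {1,…,n}∖𝒟_Ω; (3) these simple modules are uniquely determined by their annihilators, i.e. the map M(𝒟_Ω) ↦ ann_{𝕀_n}(M(𝒟_Ω)) is a bijection. -/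

import Mathlib

set_option maxHeartbeats 1000000
set_option synthInstance.maxHeartbeats 400000
set_option linter.unusedSectionVars false

namespace IDO

open scoped TensorProduct

noncomputable section

variable (K : Type*) [Field K] [CharZero K] (n : ℕ)

/-- The polynomial algebra `P_n = K[x_1, …, x_n]`. -/
abbrev P := MvPolynomial (Fin n) K

/-- The multiplication operator `x_i`. -/
def xOp (i : Fin n) : Module.End K (P K n) := LinearMap.mulLeft K (MvPolynomial.X i)

/-- The partial derivative `∂_i`. -/
def dOp (i : Fin n) : Module.End K (P K n) := (MvPolynomial.pderiv i).toLinearMap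

/-- The integration operator `∫_i`, sending `x^α ↦ x^{α+e_i}/(α_i+1)`. -/
def intOp (i : Fin n) : Module.End K (P K n) :=
  ((MvPolynomial.basisMonomials (Fin n) K).constr K)
    (fun α => (((α i : ℕ) : K) + 1)⁻¹ •
      (MvPolynomial.monomial (α + Finsupp.single i 1) (1 : K)))

/-- The algebra of polynomial integro-differential operators `𝕀_n`, as a subalgebra of
`End_K(P_n)` generated by the `x_i`, `∂_i` and `∫_i`. -/
def InSub : Subalgebra K (Module.End K (P K n)) :=
  Algebra.adjoin K (Set.range (xOp K n) ∪ Set.range (dOp K n) ∪ Set.range (intOp K n))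

/-- The algebra `𝕀_n` (as a type, with its canonical ring structure). -/
def In : Type _ := InSub K n

instance : Ring (In K n) := inferInstanceAs (Ring (InSub K n))
instance : Algebra K (In K n) := inferInstanceAs (Algebra K (InSub K n))
instance : Module (In K n) (P K n) := inferInstanceAs (Module (InSub K n) (P K n))
instance : IsScalarTower K (In K n) (P K n) :=
  inferInstanceAs (IsScalarTower K (InSub K n) (P K n))

/-- `x_i` as an element of `𝕀_n`. -/
def xEl (i : Fin n) : In K n :=
  show InSub K n from
    ⟨xOp K n i, Algebra.subset_adjoin (Set.mem_union_left _ (Set.mem_union_left _ ⟨i, rfl⟩))⟩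

/-- `∂_i` as an element of `𝕀_n`. -/
def dEl (i : Fin n) : In K n :=
  show InSub K n from
    ⟨dOp K n i, Algebra.subset_adjoin (Set.mem_union_left _ (Set.mem_union_right _ ⟨i, rfl⟩))⟩

/-- `∫_i` as an element of `𝕀_n`. -/
def intEl (i : Fin n) : In K n :=
  show InSub K n from
    ⟨intOp K n i, Algebra.subset_adjoin (Set.mem_union_right _ ⟨i, rfl⟩)⟩

/-- `H_i = ∂_i x_i` as an element of `𝕀_n`. -/
def HEl (i : Fin n) : In K n := dEl K n i * xEl K n i

section Modules

variable (M : Type*) [AddCommGroup M] [Module K M] [Module (In K n) M]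
  [IsScalarTower K (In K n) M]

/-- The weight space `M_λ = {m | H_i m = λ_i m for all i}`. -/
def weightSpace (lam : Fin n → K) : Submodule K M where
  carrier := {m | ∀ i, HEl K n i • m = lam i • m}
  add_mem' := by
    intro a b ha hb i
    rw [smul_add, ha i, hb i, smul_add]
  zero_mem' := by intro i; simp
  smul_mem' := by
    intro c m hm i
    rw [← smul_comm c (HEl K n i) m, hm i, smul_smul, mul_comm, ← smul_smul]

private lemma pow_smul_zero_mono {a : In K n} {m : M} {s s' : ℕ}
    (h : (a ^ s) • m = 0) (hle : s ≤ s') : (a ^ s') • m = 0 := by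
  obtain ⟨k, rfl⟩ := Nat.exists_eq_add_of_le hle
  rw [add_comm s k, pow_add, mul_smul, h, smul_zero]

/-- The generalized weight space `M^λ = {m | (H_i − λ_i)^N m = 0 for some N and all i}`. -/
def genWeightSpace (lam : Fin n → K) : Submodule K M where
  carrier := {m | ∃ N : ℕ, ∀ i,
    ((HEl K n i - algebraMap K (In K n) (lam i)) ^ N) • m = 0}
  add_mem' := by
    rintro a b ⟨Na, ha⟩ ⟨Nb, hb⟩
    refine ⟨Na ⊔ Nb, fun i => ?_⟩
    rw [smul_add, pow_smul_zero_mono K n M (ha i) le_sup_left,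
      pow_smul_zero_mono K n M (hb i) le_sup_right, add_zero]
  zero_mem' := ⟨0, fun i => smul_zero _⟩
  smul_mem' := by
    rintro c m ⟨N, hN⟩
    exact ⟨N, fun i => by rw [← smul_comm c _ m, hN i, smul_zero]⟩

/-- `M` is a weight module: `M = ⊕_λ M_λ`. -/
def IsWeightModule : Prop :=
  letI := Classical.decEq (Fin n → K)
  DirectSum.IsInternal (fun lam : Fin n → K => weightSpace K n M lam)

/-- `M` is a generalized weight module: `M = ⊕_λ M^λ`. -/
def IsGenWeightModule : Prop :=
  letI := Classical.decEq (Fin n → K)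
  DirectSum.IsInternal (fun lam : Fin n → K => genWeightSpace K n M lam)

/-- The support `Supp(M) = {λ | M^λ ≠ 0}`. -/
def supp : Set (Fin n → K) := {lam | genWeightSpace K n M lam ≠ ⊥}

/-- `M` is an indecomposable `𝕀_n`-module. -/
def IsIndecomposableMod : Prop :=
  Nontrivial M ∧ ∀ p q : Submodule (In K n) M, IsCompl p q → p = ⊥ ∨ q = ⊥

/-- The annihilator of an `𝕀_n`-module, as a set. -/
def annSet : Set (In K n) := {a | ∀ m : M, a • m = 0}

end Modules

/-- A prime (two-sided) ideal of the noncommutative ring `𝕀_n`, given as a set: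
`S ≠ 𝕀_n` and `a 𝕀_n b ⊆ S → a ∈ S ∨ b ∈ S`. -/
def IsPrimeSet (S : Set (In K n)) : Prop :=
  S ≠ Set.univ ∧ ∀ a b : In K n, (∀ r : In K n, a * r * b ∈ S) → a ∈ S ∨ b ∈ S

-- orbits
/-- The `ℤ^n`-orbit of `λ ∈ K^n`. -/
def orbitOf (lam : Fin n → K) : Set (Fin n → K) :=
  {mu | ∀ i, ∃ z : ℤ, mu i - lam i = (z : K)}

/-- The setoid on `K^n` whose classes are the `ℤ^n`-orbits. -/
def orbitSetoid : Setoid (Fin n → K) where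
  r mu nu := ∀ i, ∃ z : ℤ, mu i - nu i = (z : K)
  iseqv := by
    constructor
    · intro x i; exact ⟨0, by simp⟩
    · intro x y h i
      obtain ⟨z, hz⟩ := h i
      exact ⟨-z, by push_cast; linear_combination -hz⟩
    · intro x y z hxy hyz i
      obtain ⟨a, ha⟩ := hxy i
      obtain ⟨b, hb⟩ := hyz i
      exact ⟨a + b, by push_cast; linear_combination ha + hb⟩

/-- `𝔻_Ω = {i | Ω_i = ℤ}` for the orbit `Ω` of `λ`. -/
def DD (lam : Fin n → K) : Set (Fin n) := {i | ∃ z : ℤ, lam i = (z : K)}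

/-- `λ` is the normalized representative of its orbit: integer coordinates are `0`. -/
def IsNormalized (lam : Fin n → K) : Prop := ∀ i, (∃ z : ℤ, lam i = (z : K)) → lam i = 0


-- I_1 specifics
/-- The matrix units `e_{st} = ∫^s ∂^t − ∫^{s+1} ∂^{t+1}` of `𝕀_1`. -/
def eEl1 (s t : ℕ) : In K 1 :=
  intEl K 1 0 ^ s * dEl K 1 0 ^ t - intEl K 1 0 ^ (s + 1) * dEl K 1 0 ^ (t + 1)

/-- `F = ⊕ K e_{st}`, the unique proper two-sided ideal of `𝕀_1`, here as the left ideal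
generated by the `e_{st}` (the two coincide). -/
def Fideal : Submodule (In K 1) (In K 1) :=
  Submodule.span (In K 1) {a | ∃ s t : ℕ, a = eEl1 K s t}

/-- The left ideal `F + 𝕀_1 (H − μ)^s`. -/
def MslIdeal (s : ℕ) (mu : K) : Submodule (In K 1) (In K 1) :=
  Fideal K ⊔ Submodule.span (In K 1) {(HEl K 1 0 - algebraMap K (In K 1) mu) ^ s}

/-- The `𝕀_1`-module `M(s,μ) = 𝕀_1/(F + 𝕀_1 (H − μ)^s)`. -/
def Msl (s : ℕ) (mu : K) := (In K 1) ⧸ MslIdeal K s mu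

instance (s : ℕ) (mu : K) : AddCommGroup (Msl K s mu) :=
  inferInstanceAs (AddCommGroup ((In K 1) ⧸ MslIdeal K s mu))
instance (s : ℕ) (mu : K) : Module (In K 1) (Msl K s mu) :=
  inferInstanceAs (Module (In K 1) ((In K 1) ⧸ MslIdeal K s mu))
instance (s : ℕ) (mu : K) : Module K (Msl K s mu) :=
  inferInstanceAs (Module K ((In K 1) ⧸ MslIdeal K s mu))
instance (s : ℕ) (mu : K) : IsScalarTower K (In K 1) (Msl K s mu) :=
  inferInstanceAs (IsScalarTower K (In K 1) ((In K 1) ⧸ MslIdeal K s mu))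

-- two-sided ideals of I_n
/-- The element `e_{st}(i) ∈ 𝕀_n` built from the `i`-th tensor factor. -/
def eElN (i : Fin n) (s t : ℕ) : In K n :=
  intEl K n i ^ s * dEl K n i ^ t - intEl K n i ^ (s + 1) * dEl K n i ^ (t + 1)

/-- The height one prime `𝔭_i`, the two-sided ideal of `𝕀_n` generated by `F(i)`. -/
def pIdeal (i : Fin n) : TwoSidedIdeal (In K n) :=
  TwoSidedIdeal.span {a | ∃ s t : ℕ, a = eElN K n i s t}

/-- `𝔞_n(I) = Σ_{i ∈ I} 𝔭_i`. -/
def aIdeal (I : Set (Fin n)) : TwoSidedIdeal (In K n) := ⨆ i ∈ I, pIdeal K n i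


-- bundled modules
universe u

/-- A bundled `𝕀_n`-module (with compatible `K`-structure). -/
structure ModN (K : Type u) [Field K] [CharZero K] (n : ℕ) : Type (u + 1) where
  carrier : Type u
  [instAdd : AddCommGroup carrier]
  [instK : Module K carrier]
  [instIn : Module (In K n) carrier]
  [instTower : IsScalarTower K (In K n) carrier]

attribute [instance] ModN.instAdd ModN.instK ModN.instIn ModN.instTower

/-- The endomorphism of `M_1 ⊗ ⋯ ⊗ M_n` acting by `a ∈ 𝕀_1` on the `i`-th factor. -/
def tprodMap (Mi : Fin n → ModN K 1) (i : Fin n) (a : In K 1) :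
    (⨂[K] j, (Mi j).carrier) →ₗ[K] ⨂[K] j, (Mi j).carrier :=
  PiTensorProduct.map (Function.update
    (fun j => (LinearMap.id : (Mi j).carrier →ₗ[K] (Mi j).carrier)) i
    (DistribMulAction.toLinearMap K ((Mi i).carrier) a))

/-- The `𝕀_n`-module `M` "is" the tensor product `M_1 ⊗ ⋯ ⊗ M_n` of the `𝕀_1`-modules `M_i`:
there is a `K`-linear isomorphism under which the generators `x_i, ∂_i, ∫_i` of `𝕀_n` act on
the `i`-th tensor factor via the corresponding generators of `𝕀_1`. -/
def RealizesTensor (Mi : Fin n → ModN K 1) (M : Type*) [AddCommGroup M] [Module K M]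
    [Module (In K n) M] [IsScalarTower K (In K n) M] : Prop :=
  ∃ φ : M ≃ₗ[K] ⨂[K] j, (Mi j).carrier,
    ∀ (i : Fin n) (m : M),
      φ (xEl K n i • m) = tprodMap K n Mi i (xEl K 1 0) (φ m) ∧
      φ (dEl K n i • m) = tprodMap K n Mi i (dEl K 1 0) (φ m) ∧
      φ (intEl K n i • m) = tprodMap K n Mi i (intEl K 1 0) (φ m)

/-- `M` is (isomorphic to) the simple weight module `M(𝒟_Ω)` attached to the orbit of `λ`
and the subset `𝒟 ⊆ 𝔻_Ω`: the tensor product of copies of `K[x]` (for `i ∈ 𝒟`) and of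
`M(1, λ_i)` (for `i ∉ 𝒟`). -/
def RealizesMD (lam : Fin n → K) (D : Set (Fin n)) (M : Type*) [AddCommGroup M] [Module K M]
    [Module (In K n) M] [IsScalarTower K (In K n) M] : Prop :=
  ∃ Mi : Fin n → ModN K 1,
    (∀ i, i ∈ D → Nonempty ((Mi i).carrier ≃ₗ[In K 1] P K 1)) ∧
    (∀ i, i ∉ D → Nonempty ((Mi i).carrier ≃ₗ[In K 1] Msl K 1 (lam i))) ∧
    RealizesTensor K n Mi M

/-- `M` is (isomorphic to) the module `P_{n-1} ⊗ M(s, λ)` (with the copy of `M(s,λ)` placed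
in position `j`). -/
def RealizesPMs (lam : Fin n → K) (j : Fin n) (s : ℕ) (M : Type*) [AddCommGroup M] [Module K M]
    [Module (In K n) M] [IsScalarTower K (In K n) M] : Prop :=
  ∃ Mi : Fin n → ModN K 1,
    (∀ i, i ≠ j → Nonempty ((Mi i).carrier ≃ₗ[In K 1] P K 1)) ∧
    Nonempty ((Mi j).carrier ≃ₗ[In K 1] Msl K s (lam j)) ∧
    RealizesTensor K n Mi M

/-- Membership in the category `GW(𝕀_n, 𝒟_Ω)`: generalized weight modules with support in the
orbit of `λ` all of whose simple subquotients are isomorphic to `M(𝒟_Ω)`. -/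
def InGWD (lam : Fin n → K) (D : Set (Fin n)) (M : Type*) [AddCommGroup M] [Module K M]
    [Module (In K n) M] [IsScalarTower K (In K n) M] : Prop :=
  IsGenWeightModule K n M ∧ supp K n M ⊆ orbitOf K n lam ∧
  ∀ (p q : Submodule (In K n) M), p ≤ q →
    IsSimpleModule (In K n) (q ⧸ Submodule.comap q.subtype p) →
    RealizesMD K n lam D (q ⧸ Submodule.comap q.subtype p)

/-- The support `S(𝒟_Ω) = ℕ_+^{𝒟_Ω} × ∏_{i ∉ 𝒟_Ω} (λ_i + ℤ)` of the module `M(𝒟_Ω)`. -/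
def SuppMD (lam : Fin n → K) (D : Set (Fin n)) : Set (Fin n → K) :=
  {mu | (∀ i ∈ D, ∃ m : ℕ, 0 < m ∧ mu i = (m : K)) ∧
        (∀ i ∉ D, ∃ z : ℤ, mu i = lam i + (z : K))}

/-- `M` is an absolutely prime `𝕀_n`-module: its annihilator is a prime ideal and every
nonzero subfactor of `M` has the same annihilator. -/
def IsAbsolutelyPrime (M : Type*) [AddCommGroup M] [Module K M]
    [Module (In K n) M] [IsScalarTower K (In K n) M] : Prop :=
  IsPrimeSet K n (annSet K n M) ∧
  ∀ (p q : Submodule (In K n) M), p ≤ q →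
    Nontrivial (q ⧸ Submodule.comap q.subtype p) →
    annSet K n (q ⧸ Submodule.comap q.subtype p) = annSet K n M


-- the commutative subalgebra D_n = K[H_1, …, H_n]
lemma xEl_smul (i : Fin n) (p : P K n) : xEl K n i • p = MvPolynomial.X i * p := rfl

lemma dEl_smul (i : Fin n) (p : P K n) : dEl K n i • p = MvPolynomial.pderiv i p := rfl

lemma hEl_monomial (i : Fin n) (α : Fin n →₀ ℕ) (c : K) :
    HEl K n i • (MvPolynomial.monomial α c : P K n)
      = (((α i : ℕ) : K) + 1) • MvPolynomial.monomial α c := by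
  have hx : xEl K n i • (MvPolynomial.monomial α c : P K n)
      = MvPolynomial.monomial (α + Finsupp.single i 1) c := by
    rw [xEl_smul, MvPolynomial.X, MvPolynomial.monomial_mul, one_mul, add_comm]
  rw [HEl, mul_smul, hx, dEl_smul, MvPolynomial.pderiv_monomial,
    add_tsub_cancel_right, MvPolynomial.smul_monomial, Finsupp.add_apply,
    Finsupp.single_eq_same, smul_eq_mul]
  congr 1
  push_cast
  ring

private lemma In_ext {a b : In K n} (h : ∀ p : P K n, a • p = b • p) : a = b := by
  have : (show InSub K n from a) = (show InSub K n from b) :=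
    Subtype.ext (LinearMap.ext fun p => h p)
  exact this

lemma hEl_comm (i j : Fin n) : HEl K n i * HEl K n j = HEl K n j * HEl K n i := by
  apply In_ext
  intro p
  induction p using MvPolynomial.induction_on' with
  | monomial α c =>
      have key : ∀ a b : Fin n, (HEl K n a * HEl K n b) • (MvPolynomial.monomial α c : P K n)
          = ((((α b : ℕ) : K) + 1) * (((α a : ℕ) : K) + 1)) • MvPolynomial.monomial α c := by
        intro a b
        rw [mul_smul, hEl_monomial, ← smul_comm, hEl_monomial, smul_smul]
      rw [key, key, mul_comm]
  | add p q hp hq =>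
      rw [smul_add, smul_add, hp, hq]

/-- `D_n = K[H_1, …, H_n]` as a subalgebra of `𝕀_n`. -/
def DnSub : Subalgebra K (In K n) := Algebra.adjoin K (Set.range (HEl K n))

/-- The commutative algebra `D_n` (as a type). -/
def Dn : Type _ := DnSub K n

instance : CommRing (Dn K n) :=
  Algebra.adjoinCommRingOfComm K (by rintro a ⟨i, rfl⟩ b ⟨j, rfl⟩; exact hEl_comm K n i j)

instance : Algebra K (Dn K n) := inferInstanceAs (Algebra K (DnSub K n))

/-- The inclusion `D_n → 𝕀_n`. -/
def dnVal : Dn K n →+* In K n := ((DnSub K n).val : DnSub K n →ₐ[K] In K n).toRingHom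

/-- `H_i` as an element of `D_n`. -/
def HElD (i : Fin n) : Dn K n :=
  show DnSub K n from ⟨HEl K n i, Algebra.subset_adjoin ⟨i, rfl⟩⟩

lemma dn_comm (d : Dn K n) (i : Fin n) :
    dnVal K n d * HEl K n i = HEl K n i * dnVal K n d := by
  have h1 : DnSub K n ≤ Subalgebra.centralizer K (Set.range (HEl K n)) := by
    apply Algebra.adjoin_le
    rintro x ⟨j, rfl⟩
    rw [SetLike.mem_coe, Subalgebra.mem_centralizer_iff]
    rintro g ⟨i', rfl⟩
    exact hEl_comm K n i' j
  have h2 := (Subalgebra.mem_centralizer_iff K).mp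
    (h1 (show DnSub K n from d).2) (HEl K n i) ⟨i, rfl⟩
  exact h2.symm


section DnModules

variable (M : Type*) [AddCommGroup M] [Module K M] [Module (In K n) M]
  [IsScalarTower K (In K n) M]

lemma genWS_stable (lam : Fin n → K) {m : M} (hm : m ∈ genWeightSpace K n M lam)
    (d : Dn K n) : dnVal K n d • m ∈ genWeightSpace K n M lam := by
  obtain ⟨N, hN⟩ := hm
  refine ⟨N, fun i => ?_⟩
  have hc : Commute (dnVal K n d) ((HEl K n i - algebraMap K (In K n) (lam i)) ^ N) := by
    apply Commute.pow_right
    exact Commute.sub_right (dn_comm K n d i) ((Algebra.commutes (lam i) (dnVal K n d)).symm)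
  rw [← mul_smul, ← hc.eq, mul_smul, hN i, smul_zero]

instance genWS_smul (lam : Fin n → K) : SMul (Dn K n) (genWeightSpace K n M lam) :=
  ⟨fun d w => ⟨dnVal K n d • (w : M), genWS_stable K n M lam w.2 d⟩⟩

instance genWS_module (lam : Fin n → K) : Module (Dn K n) (genWeightSpace K n M lam) :=
  Module.ofMinimalAxioms
    (fun d x y => Subtype.ext (smul_add (dnVal K n d) (x : M) (y : M)))
    (fun d d' x => Subtype.ext (show dnVal K n (d + d') • (x : M)
      = dnVal K n d • (x : M) + dnVal K n d' • (x : M) by rw [map_add, add_smul]))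
    (fun d d' x => Subtype.ext (show dnVal K n (d * d') • (x : M)
      = dnVal K n d • (dnVal K n d' • (x : M)) by rw [map_mul, mul_smul]))
    (fun x => Subtype.ext (show dnVal K n 1 • (x : M) = (x : M) by rw [map_one, one_smul]))

instance genWS_tower (lam : Fin n → K) :
    IsScalarTower K (Dn K n) (genWeightSpace K n M lam) :=
  ⟨fun c d w => Subtype.ext (show dnVal K n (c • d) • (w : M) = c • (dnVal K n d • (w : M)) by
    rw [show dnVal K n (c • d) = c • dnVal K n d from map_smul (DnSub K n).val c d, smul_assoc])⟩

end DnModules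

/-- The maximal ideal `𝔪_λ = (H_1 − λ_1, …, H_n − λ_n)` of `D_n`. -/
def mIdeal (lam : Fin n → K) : Ideal (Dn K n) :=
  Ideal.span {d | ∃ i, d = HElD K n i - algebraMap K (Dn K n) (lam i)}

/-- The category `LF_𝔪(D_n)` of `𝔪_λ`-locally finite `D_n`-modules: every cyclic submodule is
finite dimensional over `K` and annihilated by a power of `𝔪_λ`. -/
def IsLF (lam : Fin n → K) (N : Type*) [AddCommGroup N] [Module K N] [Module (Dn K n) N]
    [IsScalarTower K (Dn K n) N] : Prop :=
  ∀ x : N, FiniteDimensional K ((Submodule.span (Dn K n) {x}).restrictScalars K) ∧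
    ∃ s : ℕ, ∀ i, ((HElD K n i - algebraMap K (Dn K n) (lam i)) ^ s) • x = 0

-- the algebra B_n = 𝕀_n/𝔞_n
/-- The maximal ideal `𝔞_n = 𝔭_1 + ⋯ + 𝔭_n` of `𝕀_n`. -/
def aFull : TwoSidedIdeal (In K n) := aIdeal K n Set.univ

/-- The skew Laurent polynomial algebra `B_n = 𝕀_n/𝔞_n`. -/
def Bn : Type _ := (aFull K n).ringCon.Quotient

instance : Ring (Bn K n) := inferInstanceAs (Ring (aFull K n).ringCon.Quotient)

/-- The quotient map `𝕀_n → B_n`. -/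
def toBn : In K n →+* Bn K n := RingCon.mk' _

lemma toBn_surjective : Function.Surjective (toBn K n) :=
  Quotient.mk''_surjective

/-- The composite `D_n → 𝕀_n → B_n`. -/
def bnD : Dn K n →+* Bn K n := (toBn K n).comp (dnVal K n)

/-- `B_n` as a right `D_n`-module (written as a left module structure, `d • b = b ⬝ d`). -/
instance : SMul (Dn K n) (Bn K n) := ⟨fun d b => b * bnD K n d⟩

instance : Module (Dn K n) (Bn K n) :=
  Module.ofMinimalAxioms
    (fun d x y => show (x + y) * bnD K n d = x * bnD K n d + y * bnD K n d from add_mul _ _ _)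
    (fun d d' x => show x * bnD K n (d + d') = x * bnD K n d + x * bnD K n d' by
      rw [map_add, mul_add])
    (fun d d' x => show x * bnD K n (d * d') = (x * bnD K n d') * bnD K n d by
      rw [mul_comm d d', map_mul, ← mul_assoc])
    (fun x => show x * bnD K n 1 = x by rw [map_one, mul_one])

instance : SMulCommClass (Dn K n) (Bn K n) (Bn K n) :=
  ⟨fun d b m => show (b * m) * bnD K n d = b * (m * bnD K n d) from mul_assoc b m (bnD K n d)⟩

/-- The induced module `B_n ⊗_{D_n} N` of a `D_n`-module `N`. -/
def Ind (N : Type*) [AddCommGroup N] [Module (Dn K n) N] : Type _ :=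
  (Bn K n) ⊗[Dn K n] N

section Ind

variable (N : Type*) [AddCommGroup N] [Module (Dn K n) N]

instance : AddCommGroup (Ind K n N) :=
  inferInstanceAs (AddCommGroup ((Bn K n) ⊗[Dn K n] N))

instance indModuleBn : Module (Bn K n) (Ind K n N) :=
  inferInstanceAs (Module (Bn K n) ((Bn K n) ⊗[Dn K n] N))

instance indModuleDn : Module (Dn K n) (Ind K n N) :=
  inferInstanceAs (Module (Dn K n) ((Bn K n) ⊗[Dn K n] N))

instance indModuleIn : Module (In K n) (Ind K n N) := Module.compHom _ (toBn K n)

instance indModuleK : Module K (Ind K n N) := Module.compHom _ (algebraMap K (Dn K n))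

lemma bn_algebraMap_comm (c : K) (u : Bn K n) :
    toBn K n (algebraMap K (In K n) c) * u = u * toBn K n (algebraMap K (In K n) c) := by
  obtain ⟨r, rfl⟩ := toBn_surjective K n u
  rw [← map_mul, ← map_mul, Algebra.commutes]

lemma dnVal_algebraMap (c : K) :
    dnVal K n (algebraMap K (Dn K n) c) = algebraMap K (In K n) c :=
  AlgHom.commutes (DnSub K n).val c

lemma ind_key (c : K) (w : (Bn K n) ⊗[Dn K n] N) :
    (toBn K n (algebraMap K (In K n) c)) • w = (algebraMap K (Dn K n) c) • w := by
  induction w using TensorProduct.induction_on with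
  | zero => rw [smul_zero, smul_zero]
  | tmul b x =>
      rw [TensorProduct.smul_tmul', TensorProduct.smul_tmul']
      congr 1
      show toBn K n (algebraMap K (In K n) c) * b = b * bnD K n (algebraMap K (Dn K n) c)
      have h1 : bnD K n (algebraMap K (Dn K n) c) = toBn K n (algebraMap K (In K n) c) := by
        show toBn K n (dnVal K n (algebraMap K (Dn K n) c)) = _
        rw [dnVal_algebraMap]
      rw [h1, bn_algebraMap_comm]
  | add x y hx hy => rw [smul_add, smul_add, hx, hy]

instance indTower : IsScalarTower K (In K n) (Ind K n N) := by
  constructor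
  intro c a v
  show toBn K n (c • a) • v = algebraMap K (Dn K n) c • ((toBn K n a : Bn K n) • v)
  rw [Algebra.smul_def, map_mul, mul_smul]
  exact ind_key K n N c _

end Ind


section BnQuot

variable (J : Submodule (Bn K n) (Bn K n))

instance : Module (In K n) (Bn K n ⧸ J) := Module.compHom _ (toBn K n)

instance : Module K (Bn K n ⧸ J) :=
  Module.compHom _ ((toBn K n).comp (algebraMap K (In K n)))

instance : IsScalarTower K (In K n) (Bn K n ⧸ J) := by
  constructor
  intro c a v
  show toBn K n (c • a) • v = (toBn K n (algebraMap K (In K n) c)) • (toBn K n a • v)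
  rw [Algebra.smul_def, map_mul, mul_smul]

end BnQuot

/-- The `𝕀_n`-module `M` "is" the tensor product `A ⊗ B` of an `𝕀_m`-module `A` and an
`𝕀_{n-m}`-module `B`: there is a `K`-linear isomorphism under which the generators of `𝕀_n`
with index `< m` act on the first factor (via the corresponding generators of `𝕀_m`) and the
remaining generators act on the second factor (via the generators of `𝕀_{n-m}`). -/
def RealizesSplit (m : ℕ) (A : Type*) [AddCommGroup A] [Module K A] [Module (In K m) A]
    [IsScalarTower K (In K m) A]
    (B : Type*) [AddCommGroup B] [Module K B] [Module (In K (n - m)) B]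
    [IsScalarTower K (In K (n - m)) B]
    (M : Type*) [AddCommGroup M] [Module K M] [Module (In K n) M]
    [IsScalarTower K (In K n) M] : Prop :=
  ∃ φ : M ≃ₗ[K] A ⊗[K] B,
    (∀ (i : Fin n) (hi : (i : ℕ) < m) (v : M),
      φ (xEl K n i • v) = LinearMap.rTensor B
        (DistribMulAction.toLinearMap K A (xEl K m ⟨i, hi⟩)) (φ v) ∧
      φ (dEl K n i • v) = LinearMap.rTensor B
        (DistribMulAction.toLinearMap K A (dEl K m ⟨i, hi⟩)) (φ v) ∧
      φ (intEl K n i • v) = LinearMap.rTensor B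
        (DistribMulAction.toLinearMap K A (intEl K m ⟨i, hi⟩)) (φ v)) ∧
    (∀ (i : Fin n) (hi : m ≤ (i : ℕ)) (v : M),
      φ (xEl K n i • v) = LinearMap.lTensor A
        (DistribMulAction.toLinearMap K B (xEl K (n - m) ⟨(i : ℕ) - m, by omega⟩)) (φ v) ∧
      φ (dEl K n i • v) = LinearMap.lTensor A
        (DistribMulAction.toLinearMap K B (dEl K (n - m) ⟨(i : ℕ) - m, by omega⟩)) (φ v) ∧
      φ (intEl K n i • v) = LinearMap.lTensor A
        (DistribMulAction.toLinearMap K B (intEl K (n - m) ⟨(i : ℕ) - m, by omega⟩)) (φ v))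

end


section Rel

variable {K : Type*} [Field K] [CharZero K] {n : ℕ}

lemma In_ext2 {a b : In K n}
    (h : ∀ (α : Fin n →₀ ℕ) (c : K), a • (MvPolynomial.monomial α c : P K n)
      = b • (MvPolynomial.monomial α c : P K n)) : a = b := by
  have : (show InSub K n from a) = (show InSub K n from b) := by
    refine Subtype.ext (LinearMap.ext fun p => ?_)
    change a • p = b • p
    induction p using MvPolynomial.induction_on' with
    | monomial α c => exact h α c
    | add p q hp hq => rw [smul_add, smul_add, hp, hq]
  exact this

lemma x_mono (i : Fin n) (α : Fin n →₀ ℕ) (c : K) :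
    xEl K n i • (MvPolynomial.monomial α c : P K n)
      = MvPolynomial.monomial (α + Finsupp.single i 1) c := by
  rw [xEl_smul, MvPolynomial.X, MvPolynomial.monomial_mul, one_mul, add_comm]

lemma d_mono (i : Fin n) (α : Fin n →₀ ℕ) (c : K) :
    dEl K n i • (MvPolynomial.monomial α c : P K n)
      = MvPolynomial.monomial (α - Finsupp.single i 1) (c * (α i : K)) := by
  rw [dEl_smul, MvPolynomial.pderiv_monomial]

lemma int_mono (i : Fin n) (α : Fin n →₀ ℕ) (c : K) :
    intEl K n i • (MvPolynomial.monomial α c : P K n)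
      = MvPolynomial.monomial (α + Finsupp.single i 1) (c * ((α i : K) + 1)⁻¹) := by
  change intOp K n i (MvPolynomial.monomial α c) = _
  have h : (MvPolynomial.monomial α c : P K n)
      = c • (MvPolynomial.basisMonomials (Fin n) K) α := by
    simp [MvPolynomial.smul_monomial]
  rw [h, map_smul, intOp, Module.Basis.constr_basis, MvPolynomial.smul_monomial,
    MvPolynomial.smul_monomial]
  simp

lemma nat_ne (m : ℕ) : ((m : K) + 1) ≠ 0 := by exact_mod_cast Nat.succ_ne_zero m

lemma mono_cases (i : Fin n) (α : Fin n →₀ ℕ) :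
    α i = 0 ∨ ∃ β : Fin n →₀ ℕ, α = β + Finsupp.single i 1 := by
  by_cases h : α i = 0
  · exact Or.inl h
  · right
    refine ⟨α - Finsupp.single i 1, ?_⟩
    rw [tsub_add_cancel_of_le]
    rw [Finsupp.single_le_iff]; omega

lemma d_int (i : Fin n) : dEl K n i * intEl K n i = 1 := by
  apply In_ext2; intro α c
  rw [mul_smul, int_mono, d_mono, one_smul, add_tsub_cancel_right]
  congr 1
  simp [mul_assoc, inv_mul_cancel₀ (nat_ne (K := K) (α i))]

lemma x_eq (i : Fin n) : xEl K n i = intEl K n i * HEl K n i := by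
  apply In_ext2; intro α c
  rw [mul_smul, hEl_monomial, MvPolynomial.smul_monomial, int_mono, x_mono]
  congr 1
  have := nat_ne (K := K) (α i)
  simp only [smul_eq_mul]
  field_simp

lemma H_int (i : Fin n) : HEl K n i * intEl K n i = intEl K n i * (HEl K n i + 1) := by
  apply In_ext2; intro α c
  rw [mul_smul, mul_smul, add_smul, hEl_monomial, int_mono, hEl_monomial, one_smul,
    smul_add, MvPolynomial.smul_monomial, MvPolynomial.smul_monomial, int_mono, int_mono,
    ← map_add]
  congr 1
  have := nat_ne (K := K) (α i)
  simp only [smul_eq_mul, Finsupp.add_apply, Finsupp.single_eq_same]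
  push_cast
  field_simp

lemma d_H (i : Fin n) : dEl K n i * HEl K n i = (HEl K n i + 1) * dEl K n i := by
  apply In_ext2; intro α c
  rw [mul_smul, mul_smul, add_smul, hEl_monomial, d_mono, hEl_monomial, one_smul,
     MvPolynomial.smul_monomial, d_mono, MvPolynomial.smul_monomial, ← map_add]
  rcases mono_cases i α with h | ⟨β, rfl⟩
  · simp [h]
  · congr 1
    simp only [smul_eq_mul, add_tsub_cancel_right, Finsupp.add_apply, Finsupp.single_eq_same]
    push_cast
    ring

lemma H_e (i : Fin n) : HEl K n i * (1 - intEl K n i * dEl K n i)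
    = (1 - intEl K n i * dEl K n i) := by
  apply In_ext2; intro α c
  rw [mul_smul, sub_smul, one_smul, mul_smul, d_mono, int_mono]
  rcases mono_cases i α with h | ⟨β, rfl⟩
  · simp [h, hEl_monomial]
  · have := nat_ne (K := K) (β i)
    have e : (β + Finsupp.single i 1 : Fin n →₀ ℕ) i = β i + 1 := by simp
    rw [add_tsub_cancel_right, e]
    push_cast
    rw [mul_assoc, mul_inv_cancel₀ this, mul_one, sub_self, smul_zero]

lemma single_ne {i j : Fin n} (h : i ≠ j) : (Finsupp.single i 1 : Fin n →₀ ℕ) j = 0 := by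
  rw [Finsupp.single_apply, if_neg h]

lemma comm_dd (i j : Fin n) : Commute (dEl K n i) (dEl K n j) := by
  apply In_ext2; intro α c
  rw [mul_smul, mul_smul]
  simp only [d_mono]
  by_cases h : i = j
  · subst h; rfl
  rw [Finsupp.tsub_apply, Finsupp.tsub_apply, single_ne h, single_ne (Ne.symm h), tsub_right_comm]
  congr 1
  simp only [tsub_zero]; ring

lemma comm_ii (i j : Fin n) : Commute (intEl K n i) (intEl K n j) := by
  apply In_ext2; intro α c
  rw [mul_smul, mul_smul]
  simp only [int_mono]
  by_cases h : i = j
  · subst h; rfl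
  rw [Finsupp.add_apply, Finsupp.add_apply, single_ne h, single_ne (Ne.symm h), add_right_comm]
  congr 1
  simp only [add_zero]; ring

lemma sub_add_swap {i j : Fin n} (h : i ≠ j) (α : Fin n →₀ ℕ) :
    α + Finsupp.single j 1 - Finsupp.single i 1 = α - Finsupp.single i 1 + Finsupp.single j 1 := by
  ext k
  simp only [Finsupp.add_apply, Finsupp.tsub_apply, Finsupp.single_apply]
  by_cases h1 : i = k
  · subst h1; simp [Ne.symm h]
  · simp [h1]

lemma comm_di {i j : Fin n} (h : i ≠ j) : Commute (dEl K n i) (intEl K n j) := by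
  apply In_ext2; intro α c
  rw [mul_smul, mul_smul]
  simp only [int_mono, d_mono]
  rw [Finsupp.add_apply, Finsupp.tsub_apply, single_ne h, single_ne (Ne.symm h), sub_add_swap h]
  congr 1
  simp only [tsub_zero, add_zero]; ring

lemma comm_dx {i j : Fin n} (h : i ≠ j) : Commute (dEl K n i) (xEl K n j) := by
  apply In_ext2; intro α c
  rw [mul_smul, mul_smul]
  simp only [x_mono, d_mono]
  rw [Finsupp.add_apply, single_ne (Ne.symm h), sub_add_swap h]
  congr 1

lemma comm_ix {i j : Fin n} (h : i ≠ j) : Commute (intEl K n i) (xEl K n j) := by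
  apply In_ext2; intro α c
  rw [mul_smul, mul_smul]
  simp only [x_mono, int_mono]
  rw [Finsupp.add_apply, single_ne (Ne.symm h), add_right_comm]
  congr 1

lemma comm_dH {i j : Fin n} (h : i ≠ j) : Commute (dEl K n i) (HEl K n j) :=
  (comm_dd i j).mul_right (comm_dx h)

lemma comm_iH {i j : Fin n} (h : i ≠ j) : Commute (intEl K n i) (HEl K n j) :=
  (comm_di (Ne.symm h)).symm.mul_right (comm_ix h)

lemma comm_HH (i j : Fin n) : Commute (HEl K n i) (HEl K n j) := hEl_comm K n i j

/-- induction principle for elements of `𝕀_n`. -/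
lemma In_induction {p : In K n → Prop} (a : In K n)
    (hc : ∀ c, p (algebraMap K (In K n) c)) (hx : ∀ i, p (xEl K n i))
    (hd : ∀ i, p (dEl K n i)) (hi : ∀ i, p (intEl K n i))
    (hadd : ∀ a b, p a → p b → p (a + b)) (hmul : ∀ a b, p a → p b → p (a * b)) : p a := by
  obtain ⟨a, ha⟩ := (show InSub K n from a)
  induction ha using Algebra.adjoin_induction with
  | mem x hx' =>
    rcases hx' with (⟨i, rfl⟩ | ⟨i, rfl⟩) | ⟨i, rfl⟩
    · exact hx i
    · exact hd i
    · exact hi i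
  | algebraMap r => exact hc r
  | add x y hx hy h1 h2 => exact hadd _ _ h1 h2
  | mul x y hx hy h1 h2 => exact hmul _ _ h1 h2

section
variable {M : Type*} [AddCommGroup M] [Module K M] [Module (In K n) M]
  [IsScalarTower K (In K n) M]

lemma stable_of_gen (W : Submodule K M) (hx : ∀ i, ∀ m ∈ W, xEl K n i • m ∈ W)
    (hd : ∀ i, ∀ m ∈ W, dEl K n i • m ∈ W) (hi : ∀ i, ∀ m ∈ W, intEl K n i • m ∈ W)
    (a : In K n) : ∀ m ∈ W, a • m ∈ W := by
  induction a using In_induction with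
  | hc c => intro m hm; rw [algebraMap_smul]; exact W.smul_mem _ hm
  | hx i => exact hx i
  | hd i => exact hd i
  | hi i => exact hi i
  | hadd a b ha hb => intro m hm; rw [add_smul]; exact W.add_mem (ha m hm) (hb m hm)
  | hmul a b ha hb => intro m hm; rw [mul_smul]; exact ha _ (hb m hm)

end

/-- powers: `∫^k` for `k ≥ 0`, `∂^{-k}` for `k < 0`. -/
noncomputable def gEl (K : Type*) [Field K] [CharZero K] (n : ℕ) (i : Fin n) (k : ℤ) : In K n :=
  if 0 ≤ k then intEl K n i ^ k.toNat else dEl K n i ^ (-k).toNat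

lemma gEl_zero (i : Fin n) : gEl K n i 0 = 1 := by simp [gEl]

lemma comm_gg {i j : Fin n} (h : i ≠ j) (k l : ℤ) : Commute (gEl K n i k) (gEl K n j l) := by
  unfold gEl
  split_ifs
  · exact (comm_ii i j).pow_pow _ _
  · exact (comm_di h.symm).symm.pow_pow _ _
  · exact (comm_di h).pow_pow _ _
  · exact (comm_dd i j).pow_pow _ _

lemma comm_dg {i j : Fin n} (h : i ≠ j) (k : ℤ) : Commute (dEl K n i) (gEl K n j k) := by
  unfold gEl
  split_ifs
  · exact (comm_di h).pow_right _
  · exact (comm_dd _ _).pow_right _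

lemma comm_ig {i j : Fin n} (h : i ≠ j) (k : ℤ) : Commute (intEl K n i) (gEl K n j k) := by
  unfold gEl
  split_ifs
  · exact (comm_ii _ _).pow_right _
  · exact (comm_di h.symm).symm.pow_right _

lemma comm_Hg {i j : Fin n} (h : i ≠ j) (k : ℤ) : Commute (HEl K n i) (gEl K n j k) := by
  unfold gEl
  split_ifs
  · exact (comm_iH h.symm).symm.pow_right _
  · exact (comm_dH h.symm).symm.pow_right _

lemma d_g (i : Fin n) (k : ℤ) : dEl K n i * gEl K n i k = gEl K n i (k - 1) := by
  unfold gEl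
  rcases lt_trichotomy k 0 with h | h | h
  · rw [if_neg (by omega), if_neg (by omega), ← pow_succ']
    congr 1; omega
  · subst h; simp
  · rw [if_pos (by omega), if_pos (by omega)]
    obtain ⟨m, rfl⟩ : ∃ m : ℕ, k = m + 1 := ⟨(k - 1).toNat, by omega⟩
    rw [show ((m : ℤ) + 1).toNat = m + 1 by omega, show ((m : ℤ) + 1 - 1).toNat = m by omega,
      pow_succ', ← mul_assoc, d_int, one_mul]

lemma i_g (i : Fin n) (k : ℤ) (hk : 0 ≤ k) : intEl K n i * gEl K n i k = gEl K n i (k + 1) := by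
  unfold gEl
  rw [if_pos hk, if_pos (by omega), ← pow_succ']
  congr 1; omega

lemma i_g_neg (i : Fin n) (k : ℤ) :
    intEl K n i * gEl K n i k = intEl K n i * dEl K n i * gEl K n i (k + 1) := by
  have := d_g (K := K) i (k + 1)
  rw [mul_assoc, this, add_sub_cancel_right]

lemma H_intpow (i : Fin n) (m : ℕ) :
    HEl K n i * intEl K n i ^ m = intEl K n i ^ m * (HEl K n i + (m : In K n)) := by
  induction m with
  | zero => simp
  | succ m ih =>
    rw [pow_succ, ← mul_assoc, ih, mul_assoc, add_mul, H_int, mul_assoc]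
    congr 1
    rw [(Nat.cast_commute m (intEl K n i)).eq, ← mul_add]
    push_cast; congr 1; abel

lemma H_dpow (i : Fin n) (m : ℕ) :
    (HEl K n i + (m : In K n)) * dEl K n i ^ m = dEl K n i ^ m * HEl K n i := by
  induction m with
  | zero => simp
  | succ m ih =>
    rw [pow_succ', mul_assoc, ← ih, ← mul_assoc, ← mul_assoc, mul_add, d_H]
    congr 1
    rw [← (Nat.cast_commute m (dEl K n i)).eq, ← add_mul]
    push_cast; congr 1; abel

lemma H_g (i : Fin n) (k : ℤ) :
    HEl K n i * gEl K n i k = gEl K n i k * (HEl K n i + (k : In K n)) := by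
  unfold gEl
  split_ifs with h
  · rw [H_intpow]
    obtain ⟨m, rfl⟩ := Int.eq_ofNat_of_zero_le h
    simp
  · obtain ⟨m, rfl⟩ : ∃ m : ℕ, k = -(m : ℤ) := ⟨(-k).toNat, by omega⟩
    have := H_dpow (K := K) i m
    simp only [neg_neg, Int.toNat_natCast, Int.cast_neg, Int.cast_natCast]
    rw [mul_add, ← this, add_mul, mul_neg, (Nat.cast_commute m _).eq]
    abel

end Rel

section Lat

variable {K : Type*} [Field K] [CharZero K] {n : ℕ}

lemma genWS_indep (M : Type*) [AddCommGroup M] [Module K M] [Module (In K n) M]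
    [IsScalarTower K (In K n) M] :
    iSupIndep (fun mu : Fin n → K => genWeightSpace K n M mu) := by
  let T := Module.toModuleEnd K (S := In K n) M
  let f : Fin n → Module.End K M := fun i => T (HEl K n i)
  have hT : ∀ (i : Fin n) (c : K), f i - algebraMap K (Module.End K M) c
      = T (HEl K n i - algebraMap K (In K n) c) := by
    intro i c
    ext m
    change HEl K n i • m - c • m = (HEl K n i - algebraMap K (In K n) c) • m
    rw [sub_smul, algebraMap_smul]
  have hcomm : ∀ i j, Commute (f i) (f j) := fun i j => (comm_HH i j).map T
  have key := Module.End.independent_iInf_maxGenEigenspace_of_forall_mapsTo f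
    (fun i j φ => Module.End.mapsTo_maxGenEigenspace_of_comm (hcomm j i) φ)
  refine key.mono (fun mu m hm => ?_)
  obtain ⟨N, hN⟩ := hm
  rw [Submodule.mem_iInf]
  intro i
  rw [Module.End.mem_maxGenEigenspace]
  refine ⟨N, ?_⟩
  rw [← Algebra.algebraMap_eq_smul_one, hT, ← map_pow]
  exact hN i

lemma weight_le_gen (M : Type*) [AddCommGroup M] [Module K M] [Module (In K n) M]
    [IsScalarTower K (In K n) M] (mu : Fin n → K) :
    weightSpace K n M mu ≤ genWeightSpace K n M mu := by
  intro m hm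
  refine ⟨1, fun i => ?_⟩
  rw [pow_one, sub_smul, hm i, algebraMap_smul, sub_self]

open Classical in
/-- weights of the base vector -/
noncomputable def cW (lam : Fin n → K) (D : Set (Fin n)) (i : Fin n) : K :=
  if i ∈ D then 1 else lam i

/-- index set -/
def SS (D : Set (Fin n)) : Set (Fin n → ℤ) := {α | ∀ i ∈ D, 0 ≤ α i}

/-- `b` is a lattice basis of `M` of type `(lam, D)`. -/
structure IsLat (lam : Fin n → K) (D : Set (Fin n)) (M : Type*) [AddCommGroup M] [Module K M]
    [Module (In K n) M] (b : (Fin n → ℤ) → M) : Prop where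
  zero : ∀ α, α ∉ SS D → b α = 0
  ne : ∀ α, α ∈ SS D → b α ≠ 0
  span : Submodule.span K (Set.range b) = ⊤
  d : ∀ i α, dEl K n i • b α = b (α - Pi.single i 1)
  int : ∀ i α, ¬ (i ∈ D ∧ α i = -1) → intEl K n i • b α = b (α + Pi.single i 1)
  x : ∀ i α, xEl K n i • b α = (cW lam D i + (α i : K)) • b (α + Pi.single i 1)

section
variable {lam : Fin n → K} {D : Set (Fin n)} {M : Type*} [AddCommGroup M] [Module K M]
    [Module (In K n) M] [IsScalarTower K (In K n) M] {b : (Fin n → ℤ) → M}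

lemma smul_sm (a : In K n) (c : K) (m : M) : a • c • m = c • a • m := (smul_comm c a m).symm

/-- weight -/
noncomputable def wt (lam : Fin n → K) (D : Set (Fin n)) (α : Fin n → ℤ) : Fin n → K :=
  fun i => cW lam D i + (α i : K)

lemma wt_inj (lam : Fin n → K) (D : Set (Fin n)) : Function.Injective (wt lam D) := by
  intro α β h
  funext i
  have := congrFun h i
  simpa [wt] using this

lemma IsLat.H (h : IsLat lam D M b) (i : Fin n) (α : Fin n → ℤ) :
    HEl K n i • b α = wt lam D α i • b α := by
  rw [HEl, mul_smul, h.x, smul_sm, h.d, add_sub_cancel_right]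
  rfl

lemma IsLat.mem_weight (h : IsLat lam D M b) (α : Fin n → ℤ) :
    b α ∈ weightSpace K n M (wt lam D α) := fun i => h.H i α

lemma IsLat.li (h : IsLat lam D M b) : LinearIndependent K (fun α : SS D => b α) := by
  have h1 := (genWS_indep (K := K) (n := n) M).comp (f := fun α : SS D => wt lam D α.1)
    (fun α β hh => Subtype.ext (wt_inj lam D hh))
  exact h1.linearIndependent _ (fun α => weight_le_gen M _ (h.mem_weight α.1))
    (fun α => h.ne _ α.2)

lemma IsLat.span' (h : IsLat lam D M b) :
    Submodule.span K (Set.range (fun α : SS D => b α)) = ⊤ := by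
  rw [eq_top_iff, ← h.span, Submodule.span_le]
  rintro _ ⟨α, rfl⟩
  by_cases hα : α ∈ SS D
  · exact Submodule.subset_span ⟨⟨α, hα⟩, rfl⟩
  · rw [h.zero α hα]; exact Submodule.zero_mem _

/-- the basis -/
noncomputable def IsLat.basis (h : IsLat lam D M b) : Module.Basis (SS D) K M :=
  Module.Basis.mk h.li h.span'.ge

lemma IsLat.basis_apply (h : IsLat lam D M b) (α : SS D) : h.basis α = b α := by
  simp [IsLat.basis]

lemma IsLat.iSup_weight (h : IsLat lam D M b) : ⨆ mu, weightSpace K n M mu = ⊤ := by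
  rw [eq_top_iff, ← h.span, Submodule.span_le]
  rintro _ ⟨α, rfl⟩
  exact Submodule.mem_iSup_of_mem _ (h.mem_weight α)

lemma IsLat.iSup_gen (h : IsLat lam D M b) : ⨆ mu, genWeightSpace K n M mu = ⊤ := by
  rw [eq_top_iff, ← h.iSup_weight]
  exact iSup_mono (weight_le_gen M)

lemma IsLat.isWeight (h : IsLat lam D M b) : IsWeightModule K n M := by
  classical
  have : DirectSum.IsInternal (fun mu : Fin n → K => weightSpace K n M mu) :=
    DirectSum.isInternal_submodule_of_iSupIndep_of_iSup_eq_top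
      ((genWS_indep M).mono (weight_le_gen M)) h.iSup_weight
  unfold IsWeightModule
  convert this

lemma IsLat.isGenWeight (h : IsLat lam D M b) : IsGenWeightModule K n M := by
  classical
  have : DirectSum.IsInternal (fun mu : Fin n → K => genWeightSpace K n M mu) :=
    DirectSum.isInternal_submodule_of_iSupIndep_of_iSup_eq_top
      (genWS_indep M) h.iSup_gen
  unfold IsGenWeightModule
  convert this

lemma IsLat.supp_sub (h : IsLat lam D M b) (hnorm : IsNormalized K n lam)
    (hD : D ⊆ DD K n lam) : supp K n M ⊆ orbitOf K n lam := by
  intro mu hmu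
  by_contra hcon
  apply hmu
  have hd := genWS_indep (K := K) (n := n) M mu
  have : ⨆ (j) (_ : j ≠ mu), genWeightSpace K n M j = ⊤ := by
    rw [eq_top_iff, ← h.span, Submodule.span_le]
    rintro _ ⟨α, rfl⟩
    refine Submodule.mem_iSup_of_mem (wt lam D α) (Submodule.mem_iSup_of_mem ?_
      (weight_le_gen M _ (h.mem_weight α)))
    rintro rfl
    apply hcon
    intro i
    unfold wt cW
    split_ifs with hi
    · rw [hnorm i (hD hi)]
      exact ⟨1 + α i, by push_cast; ring⟩
    · exact ⟨α i, by ring⟩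
  rw [this] at hd
  exact disjoint_top.mp hd

/-- moving between basis vectors inside a submodule -/
lemma IsLat.move (h : IsLat lam D M b) (N : Submodule (In K n) M) {α : Fin n → ℤ}
    (hα : b α ∈ N) (hα' : α ∈ SS D) (s : Finset (Fin n)) :
    ∀ β ∈ SS D, (∀ i, i ∉ s → β i = α i) → b β ∈ N := by
  classical
  induction s using Finset.induction_on with
  | empty =>
    intro β _ hβ
    have : β = α := funext fun i => hβ i (by simp)
    rwa [this]
  | insert j s hj ih =>
    intro β hβ hβs
    have main : ∀ γ, γ ∈ SS D → b γ ∈ N → ∀ m : ℕ, b (γ + Pi.single j (m : ℤ)) ∈ N := by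
      intro γ hγ hγN m
      induction m with
      | zero => simpa using hγN
      | succ m ihm =>
        have := N.smul_mem (intEl K n j) ihm
        rw [h.int j] at this
        · rw [add_assoc, ← Pi.single_add] at this
          exact_mod_cast this
        · rintro ⟨hjD, hj⟩
          have := hγ j hjD
          simp at hj
          omega
    have main2 : ∀ γ, b γ ∈ N → ∀ m : ℕ, b (γ - Pi.single j (m : ℤ)) ∈ N := by
      intro γ hγN m
      induction m with
      | zero => simpa using hγN
      | succ m ihm =>
        have := N.smul_mem (dEl K n j) ihm
        rw [h.d j, sub_sub, ← Pi.single_add] at this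
        exact_mod_cast this
    have h0 : Function.update β j (α j) ∈ SS D := by
      intro i hi
      by_cases hij : i = j
      · subst hij; simpa using hα' i hi
      · simpa [hij] using hβ i hi
    have h1 := ih (Function.update β j (α j)) h0 (by
      intro i hi
      by_cases hij : i = j
      · subst hij; simp
      · simpa [hij] using hβs i (by simp [hij, hi]))
    rcases le_total (α j) (β j) with hle | hle
    · have := main _ h0 h1 (β j - α j).toNat
      convert this using 2
      funext i
      by_cases hij : i = j
      · subst hij; simp [hle]
      · simp [hij]
    · have := main2 _ h1 (α j - β j).toNat
      convert this using 2
      funext i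
      by_cases hij : i = j
      · subst hij; simp [hle]
      · simp [hij]

lemma IsLat.simple (h : IsLat lam D M b) : IsSimpleModule (In K n) M := by
  classical
  have hne0 : (0 : Fin n → ℤ) ∈ SS D := fun i _ => le_rfl
  have hnt : Nontrivial M := ⟨⟨b 0, 0, h.ne 0 hne0⟩⟩
  rw [isSimpleModule_iff]
  refine { toNontrivial := inferInstance, eq_bot_or_eq_top := fun N => ?_ }
  by_cases hN : N = ⊥
  · exact Or.inl hN
  right
  obtain ⟨m0, hm0, hm0'⟩ := N.ne_bot_iff.mp hN
  -- minimal support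
  have hex : ∃ k : ℕ, ∃ m ∈ N, m ≠ 0 ∧ (h.basis.repr m).support.card = k :=
    ⟨_, m0, hm0, hm0', rfl⟩
  obtain ⟨m, hm, hmne, hcard⟩ := Nat.find_spec hex
  have hmin := fun k hk => Nat.find_min hex (m := k) hk
  have hreprH : ∀ (i : Fin n) (m : M) (β : SS D),
      h.basis.repr (HEl K n i • m) β = wt lam D β.1 i * h.basis.repr m β := by
    intro i m β
    have e1 : HEl K n i • m = (Module.toModuleEnd K (S := In K n) M (HEl K n i)) m := rfl
    have : (h.basis.coord β) ∘ₗ (Module.toModuleEnd K (S := In K n) M (HEl K n i))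
        = wt lam D β.1 i • h.basis.coord β := by
      refine h.basis.ext fun γ => ?_
      change h.basis.coord β (HEl K n i • h.basis γ) = wt lam D β.1 i • h.basis.coord β (h.basis γ)
      rw [h.basis_apply, h.H, map_smul, ← h.basis_apply]
      simp only [Module.Basis.coord_apply, Module.Basis.repr_self, Finsupp.single_apply]
      split_ifs with hh
      · rw [hh]
      · simp
    exact LinearMap.congr_fun this m
  have hrne : h.basis.repr m ≠ 0 := by simpa using hmne
  obtain ⟨α, hα⟩ := Finsupp.support_nonempty_iff.mpr hrne
  have hsupp : ∀ β ∈ (h.basis.repr m).support, β = α := by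
    intro β hβ
    by_contra hne
    obtain ⟨i, hi⟩ : ∃ i, β.1 i ≠ α.1 i := by
      by_contra hcon
      push Not at hcon
      exact hne (Subtype.ext (funext hcon))
    let m' := HEl K n i • m - wt lam D α.1 i • m
    have hr : ∀ γ, h.basis.repr m' γ
        = (wt lam D γ.1 i - wt lam D α.1 i) * h.basis.repr m γ := by
      intro γ
      simp only [m', map_sub, map_smul, Finsupp.sub_apply, hreprH, Finsupp.smul_apply, smul_eq_mul]
      ring
    have hm'N : m' ∈ N := by
      refine N.sub_mem (N.smul_mem _ hm) ?_
      rw [← algebraMap_smul (In K n)]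
      exact N.smul_mem _ hm
    have hm'ne : m' ≠ 0 := by
      intro h0
      have := hr β
      rw [h0] at this
      simp only [map_zero, Finsupp.coe_zero, Pi.zero_apply, zero_eq_mul] at this
      rcases this with h1 | h1
      · apply hi
        simp only [wt] at h1
        have h2 : (β.1 i : K) = (α.1 i : K) := by linear_combination h1
        exact_mod_cast h2
      · exact (Finsupp.mem_support_iff.mp hβ) h1
    refine hmin (h.basis.repr m').support.card ?_ ⟨m', hm'N, hm'ne, rfl⟩
    rw [← hcard]
    apply Finset.card_lt_card
    refine ⟨fun γ hγ => ?_, fun hcon => ?_⟩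
    · rw [Finsupp.mem_support_iff] at hγ ⊢
      intro h0
      apply hγ; rw [hr, h0, mul_zero]
    · have := hcon hα
      rw [Finsupp.mem_support_iff, hr] at this
      simp at this
  have hrepr : m = (h.basis.repr m α) • b α := by
    rw [← h.basis_apply]
    apply h.basis.repr.injective
    ext β
    rw [map_smul, Module.Basis.repr_self, Finsupp.smul_single, smul_eq_mul, mul_one,
      Finsupp.single_apply]
    split_ifs with hh
    · rw [hh]
    · by_contra hc
      exact hh (hsupp β (Finsupp.mem_support_iff.mpr hc)).symm
  have hbα : b α ∈ N := by
    have : b α = algebraMap K (In K n) (h.basis.repr m α)⁻¹ • m := by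
      have hc : h.basis.repr m α ≠ 0 := Finsupp.mem_support_iff.mp hα
      generalize h.basis.repr m α = c at hrepr hc
      rw [hrepr, algebraMap_smul, smul_smul, inv_mul_cancel₀ hc, one_smul]
    rw [this]; exact N.smul_mem _ hm
  rw [eq_top_iff]
  intro y _
  have hy : y ∈ Submodule.span K (Set.range b) := by rw [h.span]; trivial
  have hle : Submodule.span K (Set.range b) ≤ N.restrictScalars K := by
    rw [Submodule.span_le]
    rintro _ ⟨β, rfl⟩
    by_cases hβ : β ∈ SS D
    · exact h.move N hbα α.2 Finset.univ β hβ (by simp)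
    · rw [h.zero β hβ]; exact Submodule.zero_mem _
  exact hle hy

end
end Lat

section Build

variable {K : Type*} [Field K] [CharZero K] {n : ℕ}

lemma pw_gg (s : Finset (Fin n)) (α : Fin n → ℤ) :
    (s : Set (Fin n)).Pairwise (Function.onFun Commute (fun i => gEl K n i (α i))) :=
  fun _ _ _ _ h => comm_gg h _ _

/-- product of the `gEl` -/
noncomputable def GG (K : Type*) [Field K] [CharZero K] {n : ℕ} (α : Fin n → ℤ) : In K n :=
  Finset.univ.noncommProd (fun i => gEl K n i (α i)) (pw_gg _ α)

lemma GG_zero : GG K (0 : Fin n → ℤ) = 1 := by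
  unfold GG
  rw [Finset.noncommProd_eq_pow_card _ _ _ (1 : In K n)]
  · simp
  · intro i _; simp [gEl_zero]

lemma GG_split (i : Fin n) (α : Fin n → ℤ) : ∃ R : In K n,
    Commute (HEl K n i) R ∧ (∀ k, Commute (gEl K n i k) R) ∧
    ∀ k, GG K (Function.update α i k) = gEl K n i k * R := by
  classical
  refine ⟨(Finset.univ.erase i).noncommProd (fun j => gEl K n j (α j))
    (pw_gg _ α), ?_, ?_, ?_⟩
  · apply Finset.noncommProd_commute
    intro j hj
    exact comm_Hg (Finset.ne_of_mem_erase hj).symm _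
  · intro k
    apply Finset.noncommProd_commute
    intro j hj
    exact comm_gg (Finset.ne_of_mem_erase hj).symm _ _
  · intro k
    unfold GG
    rw [← Finset.mul_noncommProd_erase Finset.univ (Finset.mem_univ i)]
    congr 1
    · simp
    · apply Finset.noncommProd_congr rfl
      intro j hj
      simp [Finset.ne_of_mem_erase hj]

lemma upd_add (α : Fin n → ℤ) (i : Fin n) (k : ℤ) :
    α + Pi.single i k = Function.update α i (α i + k) := by
  funext j
  by_cases h : j = i
  · subst h; simp
  · simp [h]

lemma upd_sub (α : Fin n → ℤ) (i : Fin n) (k : ℤ) :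
    α - Pi.single i k = Function.update α i (α i - k) := by
  funext j
  by_cases h : j = i
  · subst h; simp
  · simp [h]

variable {M : Type*} [AddCommGroup M] [Module K M] [Module (In K n) M]
  [IsScalarTower K (In K n) M]

lemma cast_smul_M (k : ℤ) (m : M) : (k : In K n) • m = (k : K) • m := by
  rw [← map_intCast (algebraMap K (In K n)), algebraMap_smul]

theorem buildLat (lam : Fin n → K) (D : Set (Fin n)) (v : M) (hv : v ≠ 0)
    (hD : ∀ i ∈ D, dEl K n i • v = 0) (hH : ∀ i, HEl K n i • v = cW lam D i • v)
    (hN : ∀ i ∉ D, ∀ m : M, intEl K n i • dEl K n i • m = m)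
    (hgen : ∀ N : Submodule (In K n) M, v ∈ N → N = ⊤) :
    IsLat lam D M (fun α => GG K α • v) := by
  classical
  have hd : ∀ i α, dEl K n i • GG K α • v = GG K (α - Pi.single i 1) • v := by
    intro i α
    obtain ⟨R, -, -, h3⟩ := GG_split (K := K) i α
    have h0 := h3 (α i)
    rw [Function.update_eq_self] at h0
    rw [upd_sub, h3, h0, ← mul_smul, ← mul_assoc, d_g]
  have hzero : ∀ α, α ∉ SS D → GG K α • v = 0 := by
    intro α hα
    simp only [SS, Set.mem_ofPred_eq, not_forall, not_le] at hα
    obtain ⟨i, hi, hneg⟩ := hα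
    obtain ⟨R, -, h2, h3⟩ := GG_split (K := K) i α
    have h0 := h3 (α i)
    rw [Function.update_eq_self] at h0
    rw [h0, (h2 _).eq, mul_smul, gEl, if_neg (by omega)]
    obtain ⟨m, hm⟩ : ∃ m : ℕ, (-(α i)).toNat = m + 1 := ⟨(-(α i)).toNat - 1, by omega⟩
    rw [hm, pow_succ, mul_smul, hD i hi, smul_zero, smul_zero]
  have hint : ∀ i α, ¬ (i ∈ D ∧ α i = -1) →
      intEl K n i • GG K α • v = GG K (α + Pi.single i 1) • v := by
    intro i α hcond
    obtain ⟨R, -, -, h3⟩ := GG_split (K := K) i α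
    have h0 := h3 (α i)
    rw [Function.update_eq_self] at h0
    by_cases hpos : 0 ≤ α i
    · rw [upd_add, h3, h0, ← mul_smul, ← mul_assoc, i_g _ _ hpos]
    · by_cases hi : i ∈ D
      · have hne : α i ≠ -1 := fun h => hcond ⟨hi, h⟩
        rw [hzero α, hzero, smul_zero]
        · intro hmem
          have := hmem i hi
          simp at this; omega
        · intro hmem
          have := hmem i hi
          omega
      · rw [upd_add, h3, h0, ← mul_smul, ← mul_assoc, i_g_neg, mul_smul, mul_smul, mul_smul,
          hN i hi, mul_smul]
  have hHb : ∀ i α, HEl K n i • GG K α • v = (cW lam D i + (α i : K)) • GG K α • v := by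
    intro i α
    obtain ⟨R, h1, -, h3⟩ := GG_split (K := K) i α
    have h0 := h3 (α i)
    rw [Function.update_eq_self] at h0
    have hc : Commute (HEl K n i + (α i : In K n)) R := h1.add_left (Int.cast_commute _ _)
    rw [h0, ← mul_smul, ← mul_assoc, H_g, mul_assoc, hc.eq, ← mul_assoc, mul_smul, add_smul, hH,
      cast_smul_M, ← add_smul, smul_sm]
  have hx : ∀ i α, xEl K n i • GG K α • v
      = (cW lam D i + (α i : K)) • GG K (α + Pi.single i 1) • v := by
    intro i α
    rw [x_eq, mul_smul, hHb, smul_sm]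
    by_cases hc : i ∈ D ∧ α i = -1
    · have : cW lam D i + (α i : K) = 0 := by rw [cW, if_pos hc.1, hc.2]; simp
      rw [this, zero_smul, zero_smul]
    · rw [hint i α hc]
  have hdm : ∀ (i : Fin n) (α : Fin n → ℤ) (m : ℕ), GG K α • v = 0 → GG K (α - Pi.single i (m : ℤ)) • v = 0 := by
    intro i α m h
    induction m with
    | zero => simpa using h
    | succ m ih =>
      have := hd i (α - Pi.single i (m : ℤ))
      rw [ih, smul_zero, sub_sub, ← Pi.single_add] at this
      exact_mod_cast this.symm
  have him : ∀ i ∉ D, ∀ (α : Fin n → ℤ) (m : ℕ), GG K α • v = 0 → GG K (α + Pi.single i (m : ℤ)) • v = 0 := by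
    intro i hi α m h
    induction m with
    | zero => simpa using h
    | succ m ih =>
      have := hint i (α + Pi.single i (m : ℤ)) (fun h => hi h.1)
      rw [ih, smul_zero, add_assoc, ← Pi.single_add] at this
      exact_mod_cast this.symm
  refine ⟨hzero, ?_, ?_, hd, hint, hx⟩
  · intro α hα h0
    have : ∀ s : Finset (Fin n), GG K (fun i => if i ∈ s then 0 else α i) • v = 0 := by
      intro s
      induction s using Finset.induction_on with
      | empty => simpa using h0
      | insert j s hj ih =>
        by_cases hpos : 0 ≤ α j
        · have := hdm j _ (α j).toNat ih
          convert this using 3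
          funext i
          by_cases hij : i = j
          · subst hij; simp [hj, hpos]
          · simp [hij]
        · have hjD : j ∉ D := fun h => hpos (hα j h)
          have := him j hjD _ (-(α j)).toNat ih
          convert this using 3
          funext i
          by_cases hij : i = j
          · subst hij; simp [hj]; omega
          · simp [hij]
    have h1 := this Finset.univ
    simp only [Finset.mem_univ, if_true] at h1
    change GG K (0 : Fin n → ℤ) • v = 0 at h1
    rw [GG_zero, one_smul] at h1
    exact hv h1
  · set W := Submodule.span K (Set.range fun α : Fin n → ℤ => GG K α • v) with hW
    have hmem : ∀ α : Fin n → ℤ, GG K α • v ∈ W := fun α => Submodule.subset_span ⟨α, rfl⟩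
    have gen : ∀ a : In K n, (∀ α : Fin n → ℤ, a • GG K α • v ∈ W) → ∀ m ∈ W, a • m ∈ W := by
      intro a ha m hm
      have : W ≤ W.comap (Module.toModuleEnd K (S := In K n) M a) := by
        conv_lhs => rw [hW]
        rw [Submodule.span_le]
        rintro _ ⟨α, rfl⟩
        exact ha α
      exact this hm
    have hst := stable_of_gen (K := K) (n := n) W
      (fun i => gen _ (fun α => by rw [hx]; exact W.smul_mem _ (hmem _)))
      (fun i => gen _ (fun α => by rw [hd]; exact hmem _))
      (fun i => gen _ (fun α => by
        by_cases hc : i ∈ D ∧ α i = -1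
        · rw [hzero α, smul_zero]
          · exact W.zero_mem
          · intro hmem
            have := hmem i hc.1
            omega
        · rw [hint i α hc]; exact hmem _))
    let N : Submodule (In K n) M :=
      { carrier := W, add_mem' := fun h1 h2 => W.add_mem h1 h2, zero_mem' := W.zero_mem,
        smul_mem' := fun a m hm => hst a m hm }
    have hNt := hgen N (by
      have := hmem 0
      rw [GG_zero, one_smul] at this
      exact this)
    rw [eq_top_iff]
    intro m _
    have : m ∈ N := by rw [hNt]; trivial
    exact this

theorem latP (lam : Fin n → K) :
    IsLat lam Set.univ (P K n) (fun α => GG K α • (1 : P K n)) := by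
  refine buildLat lam Set.univ (1 : P K n) one_ne_zero ?_ ?_ ?_ ?_
  · intro i _
    rw [dEl_smul]; simp
  · intro i
    have := hEl_monomial K n i 0 1
    simpa [cW] using this
  · intro i hi; exact absurd (Set.mem_univ i) hi
  · intro N hN
    rw [eq_top_iff]
    intro p _
    induction p using MvPolynomial.induction_on with
    | C a =>
      have : (MvPolynomial.C a : P K n) = algebraMap K (In K n) a • (1 : P K n) := by
        rw [algebraMap_smul, MvPolynomial.smul_eq_C_mul, mul_one]
      rw [this]; exact N.smul_mem _ hN
    | add p q hp hq => exact N.add_mem (hp trivial) (hq trivial)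
    | mul_X p i hp =>
      have := N.smul_mem (xEl K n i) (hp trivial)
      rw [xEl_smul, mul_comm] at this
      exact this

end Build

section Symb

variable {K : Type*} [Field K] [CharZero K] {n : ℕ}

/-- functions which are polynomial in each coordinate outside `D`. -/
def QP (D : Set (Fin n)) (F : (Fin n → K) → K) : Prop :=
  ∀ i, i ∉ D → ∀ w, ∃ p : Polynomial K, ∀ t, F (Function.update w i t) = p.eval t

lemma QP.const (D : Set (Fin n)) (c : K) : QP D (fun _ => c) :=
  fun _ _ _ => ⟨Polynomial.C c, fun t => by simp⟩

lemma QP.add {D : Set (Fin n)} {F G : (Fin n → K) → K} (hF : QP D F) (hG : QP D G) :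
    QP D (fun w => F w + G w) := by
  intro i hi w
  obtain ⟨p, hp⟩ := hF i hi w
  obtain ⟨q, hq⟩ := hG i hi w
  exact ⟨p + q, fun t => by simp [hp, hq]⟩

lemma QP.mul {D : Set (Fin n)} {F G : (Fin n → K) → K} (hF : QP D F) (hG : QP D G) :
    QP D (fun w => F w * G w) := by
  intro i hi w
  obtain ⟨p, hp⟩ := hF i hi w
  obtain ⟨q, hq⟩ := hG i hi w
  exact ⟨p * q, fun t => by simp [hp, hq]⟩

lemma QP.shift {D : Set (Fin n)} {F : (Fin n → K) → K} (hF : QP D F) (β : Fin n → ℤ) :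
    QP D (fun w => F (fun i => w i + (β i : K))) := by
  intro i hi w
  obtain ⟨p, hp⟩ := hF i hi (fun i => w i + (β i : K))
  refine ⟨p.comp (Polynomial.X + Polynomial.C (β i : K)), fun t => ?_⟩
  rw [Polynomial.eval_comp]
  simp only [Polynomial.eval_add, Polynomial.eval_X, Polynomial.eval_C]
  rw [← hp]
  congr 1
  funext j
  by_cases h : j = i
  · subst h; simp
  · simp [h]

lemma QP.dense {D : Set (Fin n)} {F : (Fin n → K) → K} (hF : QP D F) (u : Fin n → K)
    (Z : Fin n → Set K) (hZ : ∀ i, (Z i).Infinite)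
    (h0 : ∀ w : Fin n → K, (∀ i ∈ D, w i = u i) → (∀ i, i ∉ D → w i ∈ Z i) → F w = 0) :
    ∀ w : Fin n → K, (∀ i ∈ D, w i = u i) → F w = 0 := by
  classical
  have key : ∀ s : Finset (Fin n), ∀ w : Fin n → K, (∀ i ∈ D, w i = u i) →
      (∀ i, i ∉ D → i ∉ s → w i ∈ Z i) → F w = 0 := by
    intro s
    induction s using Finset.induction_on with
    | empty => intro w h1 h2; exact h0 w h1 (fun i hi => h2 i hi (by simp))
    | insert j s hj ih =>
      intro w h1 h2
      by_cases hjD : j ∈ D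
      · refine ih w h1 (fun i hi his => h2 i hi ?_)
        have : i ≠ j := by rintro rfl; exact hi hjD
        simp [this, his]
      · obtain ⟨p, hp⟩ := hF j hjD w
        have hz : p = 0 := by
          refine Polynomial.eq_zero_of_infinite_isRoot p ((hZ j).mono fun t ht => ?_)
          change p.eval t = 0
          rw [← hp]
          apply ih
          · intro i hi
            have : i ≠ j := by rintro rfl; exact hjD hi
            simpa [this] using h1 i hi
          · intro i hi his
            by_cases hij : i = j
            · subst hij; simpa using ht
            · simpa [hij] using h2 i hi (by simp [hij, his])
        have := hp (w j)
        rw [Function.update_eq_self, hz] at this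
        simpa using this
  intro w hw
  exact key Finset.univ w hw (by simp)

/-- symbol lists -/
abbrev SymL (K : Type*) (n : ℕ) := List ((Fin n → ℤ) × ((Fin n → K) → K))

/-- `L` describes the action of `a` for large indices. -/
def Sym (D : Set (Fin n)) {M : Type*} [AddCommGroup M] [Module K M] [Module (In K n) M]
    (w : (Fin n → ℤ) → Fin n → K) (b : (Fin n → ℤ) → M) (L : SymL K n) (C : ℤ) (a : In K n) :
    Prop :=
  ∀ α : Fin n → ℤ, (∀ i, i ∉ D → C ≤ α i) →
    a • b α = (L.map (fun p => p.2 (w α) • b (α + p.1))).sum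

lemma exists_bound (L : SymL K n) (C : ℤ) :
    ∃ C', C ≤ C' ∧ ∀ p ∈ L, ∀ i, 0 ≤ C' + p.1 i := by
  induction L with
  | nil => exact ⟨C, le_rfl, by simp⟩
  | cons p L ih =>
    obtain ⟨C', h1, h2⟩ := ih
    obtain ⟨B, hB⟩ := (Set.finite_range (fun i => -(p.1 i))).bddAbove
    refine ⟨max C' B, le_trans h1 (le_max_left _ _), ?_⟩
    intro q hq i
    rcases List.mem_cons.mp hq with rfl | hq
    · have : -(q.1 i) ≤ B := hB ⟨i, rfl⟩
      have := le_max_right C' B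
      omega
    · have := h2 q hq i
      have := le_max_left C' B
      omega

/-- one step symbol of a generator. -/
def Step (D : Set (Fin n)) {M : Type*} [AddCommGroup M] [Module K M] [Module (In K n) M]
    (w : (Fin n → ℤ) → Fin n → K) (b : (Fin n → ℤ) → M) (ε : Fin n → ℤ) (f : (Fin n → K) → K)
    (a : In K n) : Prop :=
  ∀ α : Fin n → ℤ, (∀ i, i ∉ D → 0 ≤ α i) → a • b α = f (w α) • b (α + ε)

section
variable {D : Set (Fin n)} {M : Type*} [AddCommGroup M] [Module K M]
    [Module (In K n) M] [IsScalarTower K (In K n) M] {b : (Fin n → ℤ) → M}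

lemma wt_add (lam : Fin n → K) (D' : Set (Fin n)) (α β : Fin n → ℤ) :
    wt lam D' (α + β) = fun i => wt lam D' α i + (β i : K) := by
  funext i; simp [wt, add_assoc]

/-- left multiplication by a generator on symbols -/
def stepL (ε : Fin n → ℤ) (f : (Fin n → K) → K) (L : SymL K n) : SymL K n :=
  L.map (fun p => (p.1 + ε, fun w => f (fun i => w i + (p.1 i : K)) * p.2 w))

lemma list_smul_sum {ι : Type*} (a : In K n) (L : List ι) (f : ι → M) :
    a • (L.map f).sum = (L.map (fun p => a • f p)).sum := by
  rw [List.smul_sum, List.map_map]; rfl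

lemma Sym.step {lam : Fin n → K} {D' : Set (Fin n)} {L : SymL K n} {C C' : ℤ} {g a : In K n}
    (hg : Sym D (wt lam D') b L C g) {ε : Fin n → ℤ} {f : (Fin n → K) → K}
    (ha : Step D (wt lam D') b ε f a) (hC : C ≤ C') (hC' : ∀ p ∈ L, ∀ i, 0 ≤ C' + p.1 i) :
    Sym D (wt lam D') b (stepL ε f L) C' (a * g) := by
  intro α hα
  rw [mul_smul, hg α (fun i hi => hC.trans (hα i hi)), list_smul_sum, stepL, List.map_map]
  congr 1
  apply List.map_congr_left
  intro p hp
  rw [smul_sm, ha (α + p.1), smul_smul, wt_add]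
  · simp only [Function.comp]
    rw [mul_comm, add_assoc]
  · intro i hi
    have h1 := hα i hi
    have h2 := hC' p hp i
    simp only [Pi.add_apply]; omega

lemma Sym.mono {w : (Fin n → ℤ) → Fin n → K} {L : SymL K n} {C C' : ℤ} {a : In K n}
    (h : Sym D w b L C a) (hC : C ≤ C') : Sym D w b L C' a :=
  fun α hα => h α (fun i hi => hC.trans (hα i hi))

lemma Sym.add {w : (Fin n → ℤ) → Fin n → K} {L L' : SymL K n} {C : ℤ} {a a' : In K n}
    (h : Sym D w b L C a) (h' : Sym D w b L' C a') : Sym D w b (L ++ L') C (a + a') := by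
  intro α hα
  rw [add_smul, h α hα, h' α hα, List.map_append, List.sum_append]

lemma step_d {lam : Fin n → K} {D' : Set (Fin n)} (h : IsLat lam D' M b) (i : Fin n) :
    Step D (wt lam D') b (-Pi.single i 1) (fun _ => 1) (dEl K n i) := by
  intro α _
  rw [h.d, one_smul, sub_eq_add_neg]

lemma step_x {lam : Fin n → K} {D' : Set (Fin n)} (h : IsLat lam D' M b) (i : Fin n) :
    Step D (wt lam D') b (Pi.single i 1) (fun w => w i) (xEl K n i) := by
  intro α _
  rw [h.x]; rfl

open Classical in
/-- symbol of the integration -/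
noncomputable def intF (D : Set (Fin n)) (i : Fin n) : (Fin n → K) → K :=
  fun w => if i ∈ D ∧ w i = 0 then 0 else 1

lemma step_i {lam : Fin n → K} {D' : Set (Fin n)} (h : IsLat lam D' M b) (hD : D ⊆ D')
    (i : Fin n) :
    Step D (wt lam D') b (Pi.single i 1) (intF D i) (intEl K n i) := by
  intro α hα
  unfold intF
  split_ifs with hc
  · have : α i = -1 := by
      have h1 := hc.2
      rw [wt, cW, if_pos (hD hc.1)] at h1
      have : ((1 + α i : ℤ) : K) = 0 := by push_cast; exact h1
      have : 1 + α i = 0 := by exact_mod_cast this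
      omega
    rw [h.zero α, smul_zero, zero_smul]
    intro hmem
    have := hmem i (hD hc.1)
    omega
  · rw [one_smul, h.int]
    rintro ⟨h1, h2⟩
    by_cases hi : i ∈ D
    · apply hc
      refine ⟨hi, ?_⟩
      rw [wt, cW, if_pos h1, h2]; simp
    · have := hα i hi
      omega

lemma QP_intF (i : Fin n) : QP (K := K) D (intF D i) := by
  intro j hj w
  by_cases hi : i ∈ D
  · have : i ≠ j := by rintro rfl; exact hj hi
    exact ⟨Polynomial.C (intF D i w), fun t => by
      rw [Polynomial.eval_C]; unfold intF; rw [Function.update_of_ne this]⟩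
  · exact ⟨1, fun t => by simp [intF, hi]⟩

lemma QP_coord (i : Fin n) : QP (K := K) D (fun w => w i) := by
  intro j hj w
  by_cases h : i = j
  · subst h; exact ⟨Polynomial.X, fun t => by simp⟩
  · exact ⟨Polynomial.C (w i), fun t => by simp [h]⟩

lemma QP_stepL {ε : Fin n → ℤ} {f : (Fin n → K) → K} (hf : QP D f) {L : SymL K n}
    (hL : ∀ p ∈ L, QP D p.2) : ∀ p ∈ stepL ε f L, QP D p.2 := by
  intro p hp
  obtain ⟨q, hq, rfl⟩ := List.mem_map.mp hp
  exact (hf.shift q.1).mul (hL q hq)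

theorem exists_sym {lam : Fin n → K} {D' : Set (Fin n)} (h : IsLat lam D' M b) (hD : D ⊆ D')
    {M2 : Type*} [AddCommGroup M2] [Module K M2]
    [Module (In K n) M2] [IsScalarTower K (In K n) M2] {b2 : (Fin n → ℤ) → M2}
    {lam2 : Fin n → K} {D2 : Set (Fin n)} (h2 : IsLat lam2 D2 M2 b2) (hD2 : D ⊆ D2)
    (a : In K n) :
    ∃ (L : SymL K n) (C : ℤ), (∀ p ∈ L, QP D p.2) ∧ Sym D (wt lam D') b L C a ∧
      Sym D (wt lam2 D2) b2 L C a := by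
  let Good : In K n → Prop := fun a => ∃ (L : SymL K n) (C : ℤ), (∀ p ∈ L, QP D p.2) ∧
    Sym D (wt lam D') b L C a ∧ Sym D (wt lam2 D2) b2 L C a
  change Good a
  have hstep : ∀ (ε : Fin n → ℤ) (f : (Fin n → K) → K) (a : In K n), QP D f →
      Step D (wt lam D') b ε f a → Step D (wt lam2 D2) b2 ε f a →
      ∀ g, Good g → Good (a * g) := by
    rintro ε f a hf h1 h2 g ⟨L, C, hL, g1, g2⟩
    obtain ⟨C', hC, hC'⟩ := exists_bound L C
    exact ⟨stepL ε f L, C', QP_stepL hf hL, g1.step h1 hC hC', g2.step h2 hC hC'⟩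
  have main : ∀ g, Good g → Good (a * g) := by
    induction a using In_induction with
    | hc c =>
      apply hstep 0 (fun _ => c) _ (QP.const D c)
      · intro α _; rw [algebraMap_smul, add_zero]
      · intro α _; rw [algebraMap_smul, add_zero]
    | hx i => exact hstep _ _ _ (QP_coord i) (step_x h i) (step_x h2 i)
    | hd i => exact hstep _ _ _ (QP.const D 1) (step_d h i) (step_d h2 i)
    | hi i => exact hstep _ _ _ (QP_intF i) (step_i h hD i) (step_i h2 hD2 i)
    | hadd a a' ha ha' =>
      intro g hg
      obtain ⟨L, C, hL, g1, g2⟩ := ha g hg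
      obtain ⟨L', C', hL', g1', g2'⟩ := ha' g hg
      rw [add_mul]
      refine ⟨L ++ L', max C C', ?_, (g1.mono (le_max_left _ _)).add (g1'.mono (le_max_right _ _)),
        (g2.mono (le_max_left _ _)).add (g2'.mono (le_max_right _ _))⟩
      intro p hp
      rcases List.mem_append.mp hp with hp | hp
      · exact hL p hp
      · exact hL' p hp
    | hmul a a' ha ha' =>
      intro g hg
      rw [mul_assoc]
      exact ha _ (ha' g hg)
  have := main 1 ⟨[(0, fun _ => 1)], 0, by simpa using QP.const D 1, ?_, ?_⟩
  · rwa [mul_one] at this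
  · intro α _; simp
  · intro α _; simp

/-- total coefficient -/
def GC (L : SymL K n) (β : Fin n → ℤ) : (Fin n → K) → K :=
  fun w => (L.map (fun p => if p.1 = β then p.2 w else 0)).sum

lemma QP_GC {L : SymL K n} (hL : ∀ p ∈ L, QP D p.2) (β : Fin n → ℤ) : QP D (GC L β) := by
  induction L with
  | nil => exact QP.const D 0
  | cons q L ih =>
    have h1 := ih (fun p hp => hL p (List.mem_cons_of_mem _ hp))
    have h2 : QP D (fun w => if q.1 = β then q.2 w else 0) := by
      split_ifs
      · exact hL q List.mem_cons_self
      · exact QP.const D 0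
    exact h2.add h1

lemma coord_sym {lam : Fin n → K} {D' : Set (Fin n)} (h : IsLat lam D' M b) {L : SymL K n} {C : ℤ}
    {a : In K n} (hs : Sym D (wt lam D') b L C a) {α : Fin n → ℤ} (hα : ∀ i, i ∉ D → C ≤ α i)
    (γ : SS D') : h.basis.repr (a • b α) γ = GC L (γ.1 - α) (wt lam D' α) := by
  rw [hs α hα, ← Module.Basis.coord_apply, map_list_sum, List.map_map, GC]
  congr 1
  apply List.map_congr_left
  intro p _
  simp only [Function.comp, map_smul, smul_eq_mul]
  by_cases hm : α + p.1 ∈ SS D'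
  · have : b (α + p.1) = h.basis ⟨_, hm⟩ := (h.basis_apply ⟨_, hm⟩).symm
    rw [this, Module.Basis.coord_apply, Module.Basis.repr_self, Finsupp.single_apply]
    by_cases hh : p.1 = γ.1 - α
    · rw [if_pos hh, if_pos, mul_one]
      apply Subtype.ext; simp [hh]
    · rw [if_neg hh, if_neg, mul_zero]
      intro h'
      apply hh
      rw [← h']; simp
  · rw [h.zero _ hm, map_zero, mul_zero, if_neg]
    intro hh
    apply hm
    rw [hh]; simp

lemma eq_zero_of_coord {lam : Fin n → K} {D' : Set (Fin n)} (h : IsLat lam D' M b) {m : M}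
    (hm : ∀ γ, h.basis.repr m γ = 0) : m = 0 := by
  apply h.basis.repr.injective
  ext γ
  simp [hm γ]

lemma kill_large {lam : Fin n → K} (h : IsLat lam D M b) {a : In K n} (ha : ∀ m : M, a • m = 0) :
    ∃ C : ℤ, ∀ α : Fin n → ℤ, (∀ i, i ∉ D → C ≤ α i) → a • (GG K α • (1 : P K n)) = 0 := by
  classical
  have hP := latP (K := K) (n := n) lam
  obtain ⟨L, C, hL, h1, h2⟩ := exists_sym h (subset_refl D) hP (Set.subset_univ D) a
  refine ⟨C, fun α hα => ?_⟩
  by_cases hαS : α ∈ SS (Set.univ : Set (Fin n))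
  swap
  · have := hP.zero α hαS
    change GG K α • (1 : P K n) = 0 at this
    rw [this, smul_zero]
  apply eq_zero_of_coord hP
  intro γ
  have := coord_sym hP h2 hα γ
  rw [this]
  refine (QP_GC hL (γ.1 - α)).dense (wt lam Set.univ α)
    (fun i => {t | ∃ m : ℕ, t = lam i + ((C + m : ℤ) : K)}) ?_ ?_ _ (fun _ _ => rfl)
  · intro i
    refine Set.infinite_of_injective_forall_mem (f := fun m : ℕ => lam i + ((C + m : ℤ) : K))
      ?_ (fun m => ⟨m, rfl⟩)
    intro m m' hmm
    simpa using hmm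
  · intro w hw hwZ
    have hwZ' : ∀ i, ∃ m : ℕ, i ∉ D → w i = lam i + ((C + m : ℤ) : K) := by
      intro i
      by_cases hi : i ∈ D
      · exact ⟨0, fun h => absurd hi h⟩
      · obtain ⟨m, hm⟩ := hwZ i hi
        exact ⟨m, fun _ => hm⟩
    choose μ hμ using hwZ'
    let α' : Fin n → ℤ := fun i => if i ∈ D then α i else C + μ i
    have hα' : ∀ i, i ∉ D → C ≤ α' i := by
      intro i hi; simp only [α', if_neg hi]; omega
    have hwα : w = wt lam D α' := by
      funext i
      by_cases hi : i ∈ D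
      · rw [hw i hi]; simp [wt, cW, hi, α']
      · rw [hμ i hi]; simp [wt, cW, hi, α']
    have hγ' : α' + (γ.1 - α) ∈ SS D := by
      intro i hi
      have := γ.2 i (Set.mem_univ i)
      simp only [α', Pi.add_apply, Pi.sub_apply, if_pos hi]
      omega
    have := coord_sym h h1 hα' ⟨_, hγ'⟩
    rw [ha, add_sub_cancel_left, ← hwα] at this
    rw [← this]; simp

end
end Symb

section Ann

variable {K : Type*} [Field K] [CharZero K] {n : ℕ}

section
variable {lam : Fin n → K} {D : Set (Fin n)} {M : Type*} [AddCommGroup M] [Module K M]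
    [Module (In K n) M] [IsScalarTower K (In K n) M] {b : (Fin n → ℤ) → M}

lemma IsLat.intpow (h : IsLat lam D M b) (i : Fin n) (α : Fin n → ℤ) (hα : i ∈ D → 0 ≤ α i)
    (k : ℕ) : intEl K n i ^ k • b α = b (α + Pi.single i (k : ℤ)) := by
  induction k with
  | zero => simp
  | succ k ih =>
    rw [pow_succ', mul_smul, ih, h.int]
    · rw [add_assoc, ← Pi.single_add]; push_cast; rfl
    · rintro ⟨h1, h2⟩
      have := hα h1
      simp at h2
      omega

lemma IsLat.dpow (h : IsLat lam D M b) (i : Fin n) (α : Fin n → ℤ)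
    (k : ℕ) : dEl K n i ^ k • b α = b (α - Pi.single i (k : ℤ)) := by
  induction k with
  | zero => simp
  | succ k ih =>
    rw [pow_succ', mul_smul, ih, h.d, sub_sub, ← Pi.single_add]; push_cast; rfl

lemma IsLat.e_zero (h : IsLat lam D M b) {i : Fin n} (hi : i ∉ D) (s t : ℕ) (m : M) :
    eElN K n i s t • m = 0 := by
  have hm : m ∈ Submodule.span K (Set.range b) := by rw [h.span]; trivial
  induction hm using Submodule.span_induction with
  | mem x hx =>
    obtain ⟨α, rfl⟩ := hx
    rw [eElN, sub_smul, mul_smul, mul_smul, h.dpow, h.dpow, h.intpow _ _ (fun h => absurd h hi),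
      h.intpow _ _ (fun h => absurd h hi), sub_eq_zero]
    congr 1
    rw [sub_add_eq_add_sub, sub_add_eq_add_sub, add_sub_assoc, add_sub_assoc, ← Pi.single_sub,
      ← Pi.single_sub]
    congr 2; push_cast; ring
  | zero => rw [smul_zero]
  | add x y _ _ hx hy => rw [smul_add, hx, hy, add_zero]
  | smul c x _ hx => rw [smul_sm, hx, smul_zero]

lemma IsLat.e_ne (h : IsLat lam D M b) {i : Fin n} (hi : i ∈ D) :
    eElN K n i 0 0 • b 0 ≠ 0 := by
  have h0 : b (0 - Pi.single i ((0 + 1 : ℕ) : ℤ)) = 0 := by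
    apply h.zero
    intro hh
    have := hh i hi
    simp at this
  have : eElN K n i 0 0 • b 0 = b 0 := by
    rw [eElN, sub_smul, mul_smul, mul_smul, h.dpow, h.dpow, h0]
    simp
  rw [this]
  exact h.ne 0 (fun _ _ => le_refl _)

lemma IsLat.e_mem (h : IsLat lam D M b) (i : Fin n) :
    eElN K n i 0 0 ∈ annSet K n M ↔ i ∉ D := by
  constructor
  · intro hh hi
    exact h.e_ne hi (hh _)
  · intro hi m
    exact h.e_zero hi 0 0 m

lemma IsLat.D_eq (h : IsLat lam D M b) : D = {i | eElN K n i 0 0 ∉ annSet K n M} := by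
  ext i
  rw [Set.mem_ofPred_eq, h.e_mem, not_not]

lemma e_ne_zero (i : Fin n) : eElN K n i 0 0 ≠ 0 := by
  intro h
  have := (latP (K := K) (n := n) 0).e_ne (Set.mem_univ i)
  rw [h, zero_smul] at this
  exact this rfl

lemma one_sub_mem {I : Set (Fin n)} {i : Fin n} (hi : i ∈ I) (k : ℕ) :
    1 - intEl K n i ^ k * dEl K n i ^ k ∈ aIdeal K n I := by
  induction k with
  | zero => simp
  | succ k ih =>
    have h1 : eElN K n i k k ∈ aIdeal K n I := by
      have h2 : pIdeal K n i ≤ aIdeal K n I := le_iSup₂ (f := fun i (_ : i ∈ I) => pIdeal K n i) i hi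
      exact h2 (TwoSidedIdeal.subset_span ⟨k, k, rfl⟩)
    have := TwoSidedIdeal.add_mem _ ih h1
    rw [eElN, sub_add_sub_cancel] at this
    exact this

lemma mem_aIdeal_of_kill {I : Set (Fin n)} (C : ℕ) (s : Finset (Fin n)) (hs : ∀ i ∈ s, i ∈ I) :
    ∀ a : In K n, (∀ α : Fin n → ℤ, (∀ i ∈ s, (C : ℤ) ≤ α i) → a • (GG K α • (1 : P K n)) = 0) →
    a ∈ aIdeal K n I := by
  have hP := latP (K := K) (n := n) 0
  classical
  induction s using Finset.induction_on with
  | empty =>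
    intro a ha
    have : a = 0 := by
      apply In_ext2
      intro α c
      rw [zero_smul]
      have : ∀ m : P K n, a • m = 0 := by
        intro m
        have hm : m ∈ Submodule.span K (Set.range (fun α : Fin n → ℤ => GG K α • (1 : P K n))) := by
          rw [hP.span]; trivial
        induction hm using Submodule.span_induction with
        | mem x hx =>
          obtain ⟨α, rfl⟩ := hx
          exact ha α (by simp)
        | zero => rw [smul_zero]
        | add x y _ _ hx hy => rw [smul_add, hx, hy, add_zero]
        | smul c x _ hx => rw [smul_sm, hx, smul_zero]
      exact this _
    rw [this]
    exact TwoSidedIdeal.zero_mem _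
  | insert j s hj ih =>
    intro a ha
    have ih' := ih (fun i hi => hs i (Finset.mem_insert_of_mem hi))
    have h1 : a * intEl K n j ^ C ∈ aIdeal K n I := by
      apply ih'
      intro α hα
      by_cases hS : α ∈ SS (Set.univ : Set (Fin n))
      · have h2 := hP.intpow j α (fun _ => hS j trivial) C
        rw [mul_smul, h2]
        apply ha
        intro i hi
        by_cases hij : i = j
        · subst hij
          have := hS i trivial
          simpa using this
        · rcases Finset.mem_insert.mp hi with h | h
          · exact absurd h hij
          · simpa [hij] using hα i h
      · have := hP.zero α hS
        change GG K α • (1 : P K n) = 0 at this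
        rw [this, smul_zero]
    have h2 := TwoSidedIdeal.add_mem _ (TwoSidedIdeal.mul_mem_right _ _ (dEl K n j ^ C) h1)
      (TwoSidedIdeal.mul_mem_left _ a _
        (one_sub_mem (K := K) (hs j (Finset.mem_insert_self j s)) C))
    have h3 : a * intEl K n j ^ C * dEl K n j ^ C + a * (1 - intEl K n j ^ C * dEl K n j ^ C)
        = a := by
      rw [mul_sub, mul_one, mul_assoc, add_sub_cancel]
    rwa [h3] at h2

theorem IsLat.ann (h : IsLat lam D M b) : annSet K n M = (aIdeal K n Dᶜ : Set (In K n)) := by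
  classical
  ext a
  constructor
  · intro ha
    obtain ⟨C, hC⟩ := kill_large h ha
    apply mem_aIdeal_of_kill C.toNat (Finset.univ.filter (fun i => i ∉ D))
    · intro i hi; simpa using hi
    · intro α hα
      apply hC
      intro i hi
      have := hα i (by simpa using hi)
      omega
  · intro ha
    let T := Module.toModuleEnd K (S := In K n) M
    have h1 : aIdeal K n Dᶜ ≤ TwoSidedIdeal.ker T := by
      refine iSup₂_le (fun i hi => ?_)
      rw [pIdeal, TwoSidedIdeal.span_le]
      rintro _ ⟨s, t, rfl⟩
      rw [SetLike.mem_coe, TwoSidedIdeal.mem_ker]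
      ext m
      exact h.e_zero hi s t m
    have h2 := h1 ha
    rw [TwoSidedIdeal.mem_ker] at h2
    intro m
    exact congrArg (fun f : Module.End K M => f m) h2

lemma aIdeal_empty : (aIdeal K n (∅ : Set (Fin n)) : Set (In K n)) = {0} := by
  unfold aIdeal
  ext a
  simp

lemma IsLat.faithful (h : IsLat lam D M b) : annSet K n M = {0} ↔ D = Set.univ := by
  constructor
  · intro hh
    rw [Set.eq_univ_iff_forall]
    intro i
    by_contra hi
    have := (h.e_mem i).mpr hi
    rw [hh] at this
    exact e_ne_zero i this
  · rintro rfl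
    rw [h.ann, Set.compl_univ, aIdeal_empty]

lemma annSet_iso {M' : Type*} [AddCommGroup M'] [Module K M']
    [Module (In K n) M'] [IsScalarTower K (In K n) M'] (e : M ≃ₗ[In K n] M') :
    annSet K n M = annSet K n M' := by
  ext a
  constructor
  · intro ha m
    have := congrArg e (ha (e.symm m))
    simpa using this
  · intro ha m
    have := congrArg e.symm (ha (e m))
    simpa using this

end

end Ann

section MslSec

variable {K : Type*} [Field K] [CharZero K]

lemma e1_d (s t : ℕ) : eEl1 K s t * dEl K 1 0 = eEl1 K s (t + 1) := by
  rw [eEl1, eEl1, sub_mul, mul_assoc, mul_assoc, ← pow_succ, ← pow_succ]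

lemma e1_int_zero (s : ℕ) : eEl1 K s 0 * intEl K 1 0 = 0 := by
  rw [eEl1, sub_mul, mul_assoc, mul_assoc, zero_add, pow_one, d_int, pow_zero, one_mul, mul_one,
    ← pow_succ, sub_self]

lemma e1_int_succ (s t : ℕ) : eEl1 K s (t + 1) * intEl K 1 0 = eEl1 K s t := by
  rw [eEl1, eEl1, sub_mul, mul_assoc, mul_assoc, pow_succ, mul_assoc, d_int, mul_one,
    pow_succ (dEl K 1 0) (t + 1), mul_assoc, d_int, mul_one, ← pow_succ]

lemma id_H (s t : ℕ) : intEl K 1 0 ^ s * dEl K 1 0 ^ t * HEl K 1 0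
    = (HEl K 1 0 - (s : In K 1) + (t : In K 1)) * (intEl K 1 0 ^ s * dEl K 1 0 ^ t) := by
  have h1 := H_dpow (K := K) (n := 1) 0 t
  have h2 := H_intpow (K := K) (n := 1) 0 s
  have h3 : intEl K 1 0 ^ s * (HEl K 1 0) = (HEl K 1 0 - (s : In K 1)) * intEl K 1 0 ^ s := by
    rw [sub_mul, h2, mul_add, (Nat.cast_commute s (intEl K 1 0 ^ s)).eq, add_sub_cancel_right]
  rw [mul_assoc, ← h1, ← mul_assoc, mul_add, h3, ← (Nat.cast_commute t (intEl K 1 0 ^ s)).eq,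
    ← add_mul, mul_assoc]

lemma e1_H (s t : ℕ) : eEl1 K s t * HEl K 1 0
    = (HEl K 1 0 - (s : In K 1) + (t : In K 1)) * eEl1 K s t := by
  rw [eEl1, sub_mul, id_H, id_H, mul_sub]
  congr 2
  push_cast
  abel

lemma e1_mem (s t : ℕ) : eEl1 K s t ∈ Fideal K := Submodule.subset_span ⟨s, t, rfl⟩

lemma F_right (a : In K 1) : ∀ f ∈ Fideal K, f * a ∈ Fideal K := by
  have red : ∀ a : In K 1, (∀ s t, eEl1 K s t * a ∈ Fideal K) →
      ∀ f ∈ Fideal K, f * a ∈ Fideal K := by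
    intro a ha f hf
    unfold Fideal at hf
    induction hf using Submodule.span_induction with
    | mem x hx => obtain ⟨s, t, rfl⟩ := hx; exact ha s t
    | zero => rw [zero_mul]; exact Submodule.zero_mem _
    | add x y _ _ hx hy => rw [add_mul]; exact Submodule.add_mem _ hx hy
    | smul c x _ hx => rw [smul_eq_mul, mul_assoc]; exact Submodule.smul_mem _ c hx
  have hint : ∀ f ∈ Fideal K, f * intEl K 1 0 ∈ Fideal K := by
    apply red
    intro s t
    cases t with
    | zero => rw [e1_int_zero]; exact Submodule.zero_mem _
    | succ t => rw [e1_int_succ]; exact e1_mem s t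
  have hH : ∀ f ∈ Fideal K, f * HEl K 1 0 ∈ Fideal K := by
    apply red
    intro s t
    rw [e1_H]
    exact Submodule.smul_mem _ _ (e1_mem s t)
  induction a using In_induction with
  | hc c =>
    intro f hf
    rw [← Algebra.commutes]
    exact Submodule.smul_mem _ _ hf
  | hx i =>
    rw [Subsingleton.elim i 0, x_eq]
    intro f hf
    rw [← mul_assoc]
    exact hH _ (hint _ hf)
  | hd i =>
    rw [Subsingleton.elim i 0]
    apply red
    intro s t
    rw [e1_d]
    exact e1_mem s (t + 1)
  | hi i =>
    rw [Subsingleton.elim i 0]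
    exact hint
  | hadd a a' ha ha' =>
    intro f hf
    rw [mul_add]
    exact Submodule.add_mem _ (ha f hf) (ha' f hf)
  | hmul a a' ha ha' =>
    intro f hf
    rw [← mul_assoc]
    exact ha' _ (ha f hf)

lemma F_kill (f : In K 1) (hf : f ∈ Fideal K) :
    ∃ C : ℤ, ∀ α : Fin 1 → ℤ, C ≤ α 0 → f • (GG K α • (1 : P K 1)) = 0 := by
  have hP := latP (K := K) (n := 1) 0
  unfold Fideal at hf
  induction hf using Submodule.span_induction with
  | mem x hx =>
    obtain ⟨s, t, rfl⟩ := hx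
    refine ⟨t + 1, fun α hα => ?_⟩
    have h1 := hP.dpow 0 α t
    have h2 := hP.dpow 0 α (t + 1)
    have h3 := hP.intpow 0 (α - Pi.single 0 (t : ℤ)) (fun _ => by simp; omega) s
    have h4 := hP.intpow 0 (α - Pi.single 0 ((t + 1 : ℕ) : ℤ)) (fun _ => by simp; omega) (s + 1)
    rw [eEl1, sub_smul, mul_smul, mul_smul, h1, h2, h3, h4, sub_eq_zero]
    congr 2
    rw [sub_add_eq_add_sub, sub_add_eq_add_sub, add_sub_assoc, add_sub_assoc, ← Pi.single_sub,
      ← Pi.single_sub]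
    congr 2; push_cast; ring
  | zero => exact ⟨0, fun α _ => zero_smul _ _⟩
  | add x y _ _ hx hy =>
    obtain ⟨C, hC⟩ := hx
    obtain ⟨C', hC'⟩ := hy
    refine ⟨max C C', fun α hα => ?_⟩
    rw [add_smul, hC α (le_trans (le_max_left _ _) hα), hC' α (le_trans (le_max_right _ _) hα),
      add_zero]
  | smul c x _ hx =>
    obtain ⟨C, hC⟩ := hx
    refine ⟨C, fun α hα => ?_⟩
    rw [smul_eq_mul, mul_smul, hC α hα, smul_zero]

lemma one_not_mem (mu : K) : (1 : In K 1) ∉ MslIdeal K 1 mu := by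
  intro h
  obtain ⟨f, hf, g, hg, hfg⟩ := Submodule.mem_sup.mp h
  obtain ⟨r, rfl⟩ := Submodule.mem_span_singleton.mp hg
  rw [pow_one, smul_eq_mul] at hfg
  obtain ⟨C, hC⟩ := F_kill f hf
  have hP := latP (K := K) (n := 1) 0
  obtain ⟨L, C', hL, h1, -⟩ := exists_sym hP (Set.empty_subset _) hP (Set.empty_subset _) r
  obtain ⟨p, hp⟩ := QP_GC hL 0 0 (Set.notMem_empty _) 0
  have key : ∀ m : ℕ, ((max (max C C') 0 + m : ℤ) : K) + 1 ∈
      {t : K | Polynomial.eval t ((Polynomial.X - Polynomial.C mu) * p - 1) = 0} := by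
    intro m
    set k : ℤ := max (max C C') 0 + m with hk
    let α : Fin 1 → ℤ := fun _ => k
    have hα : α ∈ SS (Set.univ : Set (Fin 1)) := by intro i _; change 0 ≤ k; omega
    have hw : wt (0 : Fin 1 → K) Set.univ α = Function.update (0 : Fin 1 → K) 0 ((k : K) + 1) := by
      funext i
      rw [Subsingleton.elim i 0, Function.update_self, wt, cW, if_pos (Set.mem_univ _), add_comm]
    have e1 := coord_sym hP h1 (α := α) (fun i _ => by change C' ≤ k; omega) ⟨α, hα⟩
    have e2 : GG K α • (1 : P K 1) = r • ((k : K) + 1 - mu) • (GG K α • (1 : P K 1)) := by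
      have h3 := congrArg (fun a : In K 1 => a • (GG K α • (1 : P K 1))) hfg
      simp only [add_smul, one_smul, mul_smul, sub_smul] at h3
      have hH := hP.H 0 α
      rw [hC α (by change C ≤ k; omega), zero_add, hH, hw, Function.update_self,
        algebraMap_smul, ← sub_smul] at h3
      exact h3.symm
    rw [smul_sm] at e2
    have e3 := congrArg (fun m => hP.basis.repr m ⟨α, hα⟩) e2
    simp only [map_smul, Finsupp.smul_apply, smul_eq_mul] at e3
    rw [e1] at e3
    have e4 : hP.basis.repr (GG K α • (1 : P K 1)) ⟨α, hα⟩ = 1 := by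
      have := hP.basis_apply ⟨α, hα⟩
      change _ = GG K α • (1 : P K 1) at this
      rw [← this, Module.Basis.repr_self, Finsupp.single_eq_same]
    rw [e4, hw, sub_self, hp] at e3
    simp only [Set.mem_ofPred_eq, Polynomial.eval_sub, Polynomial.eval_mul, Polynomial.eval_X,
      Polynomial.eval_C, Polynomial.eval_one]
    rw [← e3, sub_self]
  have hz : (Polynomial.X - Polynomial.C mu) * p - 1 = 0 := by
    apply Polynomial.eq_zero_of_infinite_isRoot
    refine Set.infinite_of_injective_forall_mem
      (f := fun m : ℕ => ((max (max C C') 0 + m : ℤ) : K) + 1) ?_ key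
    intro m m' hmm
    simpa using hmm
  have := congrArg (Polynomial.eval mu) hz
  simp at this

/-- generator -/
noncomputable def mslV (mu : K) : Msl K 1 mu :=
  (Submodule.Quotient.mk 1 : (In K 1) ⧸ MslIdeal K 1 mu)

lemma msl_mk (mu : K) (m : Msl K 1 mu) : ∃ a : In K 1, m = a • mslV mu := by
  obtain ⟨a, rfl⟩ := Submodule.Quotient.mk_surjective (MslIdeal K 1 mu) m
  refine ⟨a, ?_⟩
  change _ = (Submodule.Quotient.mk (a • (1 : In K 1)) : (In K 1) ⧸ MslIdeal K 1 mu)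
  rw [smul_eq_mul, mul_one]

lemma msl_smul_eq_zero (mu : K) {a : In K 1} : a • mslV mu = 0 ↔ a ∈ MslIdeal K 1 mu := by
  have h1 : a • mslV mu = (Submodule.Quotient.mk a : (In K 1) ⧸ MslIdeal K 1 mu) := by
    change (Submodule.Quotient.mk (a • (1 : In K 1)) : (In K 1) ⧸ MslIdeal K 1 mu) = _
    rw [smul_eq_mul, mul_one]
  rw [h1]
  exact Submodule.Quotient.mk_eq_zero _

theorem latMsl (mu : K) : IsLat (fun _ : Fin 1 => mu) ∅ (Msl K 1 mu)
    (fun α => GG K α • mslV mu) := by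
  apply buildLat
  · intro h
    apply one_not_mem mu
    rw [← msl_smul_eq_zero, one_smul, h]
  · intro i hi; exact absurd hi (Set.notMem_empty i)
  · intro i
    rw [Subsingleton.elim i 0, cW, if_neg (Set.notMem_empty _), ← sub_eq_zero,
      ← algebraMap_smul (In K 1) mu (mslV mu), ← sub_smul, msl_smul_eq_zero]
    apply Submodule.mem_sup_right
    rw [pow_one]
    exact Submodule.mem_span_singleton_self _
  · intro i _ m
    obtain ⟨a, rfl⟩ := msl_mk mu m
    rw [Subsingleton.elim i 0]
    symm
    rw [← sub_eq_zero, ← mul_smul, ← mul_smul, ← sub_smul, msl_smul_eq_zero]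
    apply Submodule.mem_sup_left
    have := F_right a _ (e1_mem (K := K) 0 0)
    rw [eEl1] at this
    simp only [pow_zero, zero_add, pow_one, mul_one, sub_mul, one_mul] at this
    rwa [mul_assoc] at this
  · intro N hN
    rw [eq_top_iff]
    intro m _
    obtain ⟨a, rfl⟩ := msl_mk mu m
    exact N.smul_mem a hN

end MslSec

section Tens

universe uu

variable {K : Type uu} [Field K] [CharZero K] {n : ℕ}

lemma map_smul_K {M M' : Type*} [AddCommGroup M] [Module K M]
    [Module (In K n) M] [IsScalarTower K (In K n) M] [AddCommGroup M'] [Module K M']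
    [Module (In K n) M'] [IsScalarTower K (In K n) M'] (e : M →ₗ[In K n] M') (c : K) (m : M) :
    e (c • m) = c • e m := by
  rw [← algebraMap_smul (In K n) c m, map_smul, algebraMap_smul]

lemma IsLat.transport {lam : Fin n → K} {D : Set (Fin n)}
    {M M' : Type*} [AddCommGroup M] [Module K M]
    [Module (In K n) M] [IsScalarTower K (In K n) M] [AddCommGroup M'] [Module K M']
    [Module (In K n) M'] [IsScalarTower K (In K n) M'] {b : (Fin n → ℤ) → M}
    (h : IsLat lam D M b) (e : M ≃ₗ[In K n] M') : IsLat lam D M' (fun α => e (b α)) where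
  zero α hα := by rw [h.zero α hα, map_zero]
  ne α hα := by
    intro hh
    exact h.ne α hα (e.map_eq_zero_iff.mp hh)
  span := by
    let f : M →ₗ[K] M' :=
      { toFun := e, map_add' := e.map_add, map_smul' := fun c m => map_smul_K e.toLinearMap c m }
    have h1 : Submodule.map f (Submodule.span K (Set.range b)) = ⊤ := by
      rw [h.span, Submodule.map_top, LinearMap.range_eq_top]
      exact e.surjective
    rw [Submodule.map_span, ← Set.range_comp] at h1
    exact h1
  d i α := by rw [← map_smul, h.d]
  int i α hα := by rw [← map_smul, h.int i α hα]
  x i α := by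
    rw [← map_smul, h.x]
    exact map_smul_K e.toLinearMap _ _

variable {lam : Fin n → K} {D : Set (Fin n)} {Mi : Fin n → ModN K 1}
  {bj : ∀ j, (Fin 1 → ℤ) → (Mi j).carrier}

/-- tensor lattice -/
noncomputable def tv (bj : ∀ j, (Fin 1 → ℤ) → (Mi j).carrier) (α : Fin n → ℤ) :
    ⨂[K] j, (Mi j).carrier :=
  PiTensorProduct.tprod K (fun j => bj j (fun _ => α j))

lemma tprodMap_tprod (i : Fin n) (a : In K 1) (m : ∀ j, (Mi j).carrier) :
    tprodMap K n Mi i a (PiTensorProduct.tprod K m)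
      = PiTensorProduct.tprod K (Function.update m i (a • m i)) := by
  rw [tprodMap, PiTensorProduct.map_tprod]
  congr 1
  funext j
  by_cases hj : j = i
  · subst hj
    simp only [Function.update_self]
    rfl
  · simp [hj]

lemma tv_upd (bj : ∀ j, (Fin 1 → ℤ) → (Mi j).carrier) (α : Fin n → ℤ) (i : Fin n) (k : ℤ) :
    tv bj (α + Pi.single i k) = PiTensorProduct.tprod K (Function.update
      (fun j => bj j (fun _ => α j)) i (bj i (fun _ => α i + k))) := by
  rw [tv]
  congr 1
  funext j
  by_cases hj : j = i
  · subst hj; simp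
  · simp [hj]

/-- one-dimensional index -/
def Dj (D : Set (Fin n)) (j : Fin n) : Set (Fin 1) := {_x | j ∈ D}

lemma mem_Dj {j : Fin n} {k : Fin 1} : k ∈ Dj D j ↔ j ∈ D := Iff.rfl

lemma tv_zero (hb : ∀ j, IsLat (fun _ : Fin 1 => lam j) (Dj D j) (Mi j).carrier (bj j))
    {α : Fin n → ℤ} (hα : α ∉ SS D) : tv bj α = 0 := by
  have : ∃ j, j ∈ D ∧ ¬ 0 ≤ α j := by
    by_contra hh
    push Not at hh
    exact hα hh
  obtain ⟨j, hj, h0⟩ := this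
  apply MultilinearMap.map_coord_zero _ j
  apply (hb j).zero
  intro h
  exact h0 (h 0 hj)

lemma tv_d (hb : ∀ j, IsLat (fun _ : Fin 1 => lam j) (Dj D j) (Mi j).carrier (bj j))
    (i : Fin n) (α : Fin n → ℤ) :
    tprodMap K n Mi i (dEl K 1 0) (tv bj α) = tv bj (α - Pi.single i 1) := by
  rw [sub_eq_add_neg, ← Pi.single_neg, tv_upd, tv, tprodMap_tprod, (hb i).d]
  congr 3
  funext k
  rw [Subsingleton.elim k 0]
  simp [sub_eq_add_neg]

lemma tv_int (hb : ∀ j, IsLat (fun _ : Fin 1 => lam j) (Dj D j) (Mi j).carrier (bj j))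
    (i : Fin n) (α : Fin n → ℤ) (h : ¬ (i ∈ D ∧ α i = -1)) :
    tprodMap K n Mi i (intEl K 1 0) (tv bj α) = tv bj (α + Pi.single i 1) := by
  rw [tv_upd, tv, tprodMap_tprod, (hb i).int _ _ h]
  congr 3
  funext k
  rw [Subsingleton.elim k 0]
  simp

lemma cW_Dj (i : Fin n) : cW (fun _ : Fin 1 => lam i) (Dj D i) 0 = cW lam D i := by
  by_cases h : i ∈ D
  · rw [cW, cW, if_pos h, if_pos (mem_Dj.mpr h)]
  · rw [cW, cW, if_neg h, if_neg (fun h' => h (mem_Dj.mp h'))]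

lemma tv_x (hb : ∀ j, IsLat (fun _ : Fin 1 => lam j) (Dj D j) (Mi j).carrier (bj j))
    (i : Fin n) (α : Fin n → ℤ) :
    tprodMap K n Mi i (xEl K 1 0) (tv bj α)
      = (cW lam D i + (α i : K)) • tv bj (α + Pi.single i 1) := by
  rw [tv_upd, tv, tprodMap_tprod, (hb i).x, MultilinearMap.map_update_smul, cW_Dj]
  congr 4
  funext k
  rw [Subsingleton.elim k 0]
  simp

section

/-- product basis -/
noncomputable def tB
    (hb : ∀ j, IsLat (fun _ : Fin 1 => lam j) (Dj D j) (Mi j).carrier (bj j)) : Module.Basis (∀ j, SS (Dj D j)) K (⨂[K] j, (Mi j).carrier) :=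
  Basis.piTensorProduct (fun j => (hb j).basis)

/-- reindex -/
def ix (α : SS D) : ∀ j, SS (Dj D j) := fun j => ⟨fun _ => α.1 j, fun _ hi => α.2 j hi⟩

lemma tv_eq
    (hb : ∀ j, IsLat (fun _ : Fin 1 => lam j) (Dj D j) (Mi j).carrier (bj j)) (α : SS D) : tv bj α.1 = tB hb (ix α) := by
  rw [tB, Basis.piTensorProduct_apply, tv]
  congr 1
  funext j
  rw [(hb j).basis_apply]
  rfl

lemma tB_eq
    (hb : ∀ j, IsLat (fun _ : Fin 1 => lam j) (Dj D j) (Mi j).carrier (bj j)) (p : ∀ j, SS (Dj D j)) : tB hb p = tv bj (fun j => (p j).1 0) := by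
  rw [tB, Basis.piTensorProduct_apply, tv]
  congr 1
  funext j
  rw [(hb j).basis_apply]
  congr 1
  funext k
  rw [Subsingleton.elim k 0]

lemma tv_li
    (hb : ∀ j, IsLat (fun _ : Fin 1 => lam j) (Dj D j) (Mi j).carrier (bj j)) : LinearIndependent K (fun α : SS D => tv bj α.1) := by
  have : (fun α : SS D => tv bj α.1) = tB hb ∘ ix := funext (tv_eq hb)
  rw [this]
  apply (tB hb).linearIndependent.comp
  intro α β h
  apply Subtype.ext
  funext j
  exact congrFun (congrArg Subtype.val (congrFun h j)) 0

lemma tv_span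
    (hb : ∀ j, IsLat (fun _ : Fin 1 => lam j) (Dj D j) (Mi j).carrier (bj j)) : Submodule.span K (Set.range (fun α : SS D => tv bj α.1)) = ⊤ := by
  rw [eq_top_iff, ← (tB hb).span_eq, Submodule.span_le]
  rintro _ ⟨p, rfl⟩
  apply Submodule.subset_span
  exact ⟨⟨fun j => (p j).1 0, fun j hj => (p j).2 0 hj⟩, (tB_eq hb p).symm⟩

lemma lat_of_tensor
    (hb : ∀ j, IsLat (fun _ : Fin 1 => lam j) (Dj D j) (Mi j).carrier (bj j)) {M : Type*} [AddCommGroup M] [Module K M]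
    [Module (In K n) M] [IsScalarTower K (In K n) M] (hM : RealizesTensor K n Mi M) :
    ∃ b, IsLat lam D M b := by
  obtain ⟨φ, hφ⟩ := hM
  refine ⟨fun α => φ.symm (tv bj α), ?_, ?_, ?_, ?_, ?_, ?_⟩
  · intro α hα
    rw [tv_zero hb hα, map_zero]
  · intro α hα h
    exact (tv_li hb).ne_zero ⟨α, hα⟩ (φ.symm.map_eq_zero_iff.mp h)
  · have h1 : Submodule.map φ.symm.toLinearMap
        (Submodule.span K (Set.range (fun α : SS D => tv bj α.1))) = ⊤ := by
      rw [tv_span hb, Submodule.map_top, LinearMap.range_eq_top]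
      exact φ.symm.surjective
    rw [Submodule.map_span, ← Set.range_comp] at h1
    rw [eq_top_iff, ← h1]
    apply Submodule.span_mono
    rintro _ ⟨α, rfl⟩
    exact ⟨α.1, rfl⟩
  · intro i α
    apply φ.injective
    rw [(hφ i _).2.1, φ.apply_symm_apply, φ.apply_symm_apply, tv_d hb]
  · intro i α h
    apply φ.injective
    rw [(hφ i _).2.2, φ.apply_symm_apply, φ.apply_symm_apply, tv_int hb i α h]
  · intro i α
    apply φ.injective
    rw [(hφ i _).1, φ.apply_symm_apply, map_smul, φ.apply_symm_apply, tv_x hb]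

lemma tensor_of_lat
    (hb : ∀ j, IsLat (fun _ : Fin 1 => lam j) (Dj D j) (Mi j).carrier (bj j)) {M : Type*} [AddCommGroup M] [Module K M]
    [Module (In K n) M] [IsScalarTower K (In K n) M] {b : (Fin n → ℤ) → M}
    (h : IsLat lam D M b) : RealizesTensor K n Mi M := by
  let tb : Module.Basis (SS D) K (⨂[K] j, (Mi j).carrier) :=
    Module.Basis.mk (tv_li hb) (tv_span hb).ge
  let φ : M ≃ₗ[K] ⨂[K] j, (Mi j).carrier := h.basis.equiv tb (Equiv.refl _)
  have hφS : ∀ α (hα : α ∈ SS D), φ (b α) = tv bj α := by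
    intro α hα
    have h1 : b α = h.basis ⟨α, hα⟩ := (h.basis_apply ⟨α, hα⟩).symm
    rw [h1, Module.Basis.equiv_apply]
    simp [tb]
  have hφ : ∀ α, φ (b α) = tv bj α := by
    intro α
    by_cases hα : α ∈ SS D
    · exact hφS α hα
    · rw [h.zero α hα, tv_zero hb hα, map_zero]
  have ext : ∀ (i : Fin n) (a : In K n) (a1 : In K 1),
      (∀ α ∈ SS D, φ (a • b α) = tprodMap K n Mi i a1 (φ (b α))) →
      ∀ m, φ (a • m) = tprodMap K n Mi i a1 (φ m) := by
    intro i a a1 hh m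
    have hm : m ∈ Submodule.span K (Set.range (fun α : SS D => b α)) := by
      rw [h.span']; trivial
    induction hm using Submodule.span_induction with
    | mem x hx => obtain ⟨α, rfl⟩ := hx; exact hh α.1 α.2
    | zero => simp
    | add x y _ _ hx hy => rw [smul_add, map_add, hx, hy, map_add, map_add]
    | smul c x _ hx => rw [smul_sm, map_smul, hx, map_smul, map_smul]
  refine ⟨φ, fun i m => ⟨?_, ?_, ?_⟩⟩
  · apply ext
    intro α _
    rw [h.x, map_smul, hφ, hφ, tv_x hb]
  · apply ext
    intro α _
    rw [h.d, hφ, hφ, tv_d hb]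
  · apply ext
    intro α hα
    have hc : ¬ (i ∈ D ∧ α i = -1) := by
      rintro ⟨h1, h2⟩
      have := hα i h1
      omega
    rw [h.int i α hc, hφ, hφ, tv_int hb i α hc]

end

lemma exists_bj (h1 : ∀ i, i ∈ D → Nonempty ((Mi i).carrier ≃ₗ[In K 1] P K 1))
    (h2 : ∀ i, i ∉ D → Nonempty ((Mi i).carrier ≃ₗ[In K 1] Msl K 1 (lam i))) :
    ∃ bj : ∀ j, (Fin 1 → ℤ) → (Mi j).carrier,
      ∀ j, IsLat (fun _ : Fin 1 => lam j) (Dj D j) (Mi j).carrier (bj j) := by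
  have : ∀ j, ∃ b : (Fin 1 → ℤ) → (Mi j).carrier,
      IsLat (fun _ : Fin 1 => lam j) (Dj D j) (Mi j).carrier b := by
    intro j
    by_cases hj : j ∈ D
    · obtain ⟨e⟩ := h1 j hj
      have hD : Dj D j = Set.univ := Set.eq_univ_of_forall (fun _ => hj)
      rw [hD]
      exact ⟨_, (latP (K := K) (n := 1) (fun _ => lam j)).transport e.symm⟩
    · obtain ⟨e⟩ := h2 j hj
      have hD : Dj D j = ∅ := Set.eq_empty_of_forall_notMem (fun _ h => hj h)
      rw [hD]
      exact ⟨_, (latMsl (lam j)).transport e.symm⟩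
  choose bj hbj using this
  exact ⟨bj, hbj⟩

theorem lat_of_MD {M : Type*} [AddCommGroup M] [Module K M]
    [Module (In K n) M] [IsScalarTower K (In K n) M] (hM : RealizesMD K n lam D M) :
    ∃ b, IsLat lam D M b := by
  obtain ⟨Mi, h1, h2, h3⟩ := hM
  obtain ⟨bj, hb⟩ := exists_bj h1 h2
  exact lat_of_tensor hb h3

theorem MD_of_lat {M : Type*} [AddCommGroup M] [Module K M]
    [Module (In K n) M] [IsScalarTower K (In K n) M] {b : (Fin n → ℤ) → M}
    (h : IsLat lam D M b) : RealizesMD K n lam D M := by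
  have : ∀ i, ∃ N : ModN K 1, (i ∈ D → Nonempty (N.carrier ≃ₗ[In K 1] P K 1)) ∧
      (i ∉ D → Nonempty (N.carrier ≃ₗ[In K 1] Msl K 1 (lam i))) := by
    intro i
    by_cases hi : i ∈ D
    · exact ⟨⟨P K 1⟩, fun _ => ⟨LinearEquiv.refl _ _⟩, fun h => absurd hi h⟩
    · exact ⟨⟨Msl K 1 (lam i)⟩, fun h => absurd h hi, fun _ => ⟨LinearEquiv.refl _ _⟩⟩
  choose Mi h1 h2 using this
  obtain ⟨bj, hb⟩ := exists_bj h1 h2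
  exact ⟨Mi, h1, h2, tensor_of_lat hb h⟩

end Tens

section Classif

variable {K : Type*} [Field K] [CharZero K] {n : ℕ}
  {M : Type*} [AddCommGroup M] [Module K M]
  [Module (In K n) M] [IsScalarTower K (In K n) M]

lemma exists_last {a : In K n} {v : M} (hv : v ≠ 0) (h : ∃ N : ℕ, a ^ N • v = 0) :
    ∃ k : ℕ, a ^ k • v ≠ 0 ∧ a • a ^ k • v = 0 := by
  classical
  have hs := Nat.find_spec h
  have hm := fun m => Nat.find_min h (m := m)
  obtain ⟨k, hk⟩ : ∃ k, Nat.find h = k + 1 := by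
    apply Nat.exists_eq_succ_of_ne_zero
    intro h0
    rw [h0, pow_zero, one_smul] at hs
    exact hv hs
  refine ⟨k, hm k (by omega), ?_⟩
  rw [hk, pow_succ', mul_smul] at hs
  exact hs

lemma exists_eig {mu : Fin n → K} {v0 : M} (hv0 : v0 ≠ 0) (hg : v0 ∈ genWeightSpace K n M mu) :
    ∃ v : M, v ≠ 0 ∧ v ∈ weightSpace K n M mu := by
  classical
  have key : ∀ s : Finset (Fin n), ∃ v : M, v ≠ 0 ∧ v ∈ genWeightSpace K n M mu ∧
      ∀ i ∈ s, HEl K n i • v = mu i • v := by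
    intro s
    induction s using Finset.induction_on with
    | empty => exact ⟨v0, hv0, hg, by simp⟩
    | insert j s hj ih =>
      obtain ⟨v, hv, ⟨N, hN⟩, hs⟩ := ih
      obtain ⟨k, hk, hk'⟩ := exists_last hv ⟨N, hN j⟩
      have hc : ∀ i, Commute (HEl K n i)
          ((HEl K n j - algebraMap K (In K n) (mu j)) ^ k) := fun i =>
        ((comm_HH i j).sub_right (Algebra.commutes (mu j) (HEl K n i)).symm).pow_right k
      have hc2 : ∀ i, Commute ((HEl K n i - algebraMap K (In K n) (mu i)) ^ N)
          ((HEl K n j - algebraMap K (In K n) (mu j)) ^ k) := fun i =>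
        ((hc i).sub_left (Algebra.commutes (mu i) _)).pow_left N
      refine ⟨_, hk, ⟨N, fun i => ?_⟩, fun i hi => ?_⟩
      · rw [← mul_smul, (hc2 i).eq, mul_smul, hN i, smul_zero]
      · rcases Finset.mem_insert.mp hi with rfl | hi
        · rw [sub_smul, algebraMap_smul, sub_eq_zero] at hk'
          exact hk'
        · rw [← mul_smul, (hc i).eq, mul_smul, hs i hi, smul_sm]
  obtain ⟨v, hv, -, hs⟩ := key Finset.univ
  exact ⟨v, hv, fun i => hs i (Finset.mem_univ i)⟩

/-- the d-torsion -/
def Tsub (M : Type*) [AddCommGroup M] [Module K M]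
    [Module (In K n) M] [IsScalarTower K (In K n) M] (j : Fin n) : Submodule K M where
  carrier := {m | ∃ k : ℕ, dEl K n j ^ k • m = 0}
  add_mem' := by
    rintro a b ⟨k, hk⟩ ⟨l, hl⟩
    refine ⟨k + l, ?_⟩
    have h1 : dEl K n j ^ (k + l) • a = 0 := by
      rw [add_comm, pow_add, mul_smul, hk, smul_zero]
    have h2 : dEl K n j ^ (k + l) • b = 0 := by
      rw [pow_add, mul_smul, hl, smul_zero]
    rw [smul_add, h1, h2, add_zero]
  zero_mem' := ⟨0, smul_zero _⟩
  smul_mem' := by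
    rintro c m ⟨k, hk⟩
    exact ⟨k, by rw [smul_sm, hk, smul_zero]⟩

lemma Tsub_stable (j : Fin n) (a : In K n) : ∀ m ∈ Tsub (K := K) M j, a • m ∈ Tsub (K := K) M j := by
  have hi : ∀ (i : Fin n), ∀ m ∈ Tsub (K := K) M j, intEl K n i • m ∈ Tsub (K := K) M j := by
    rintro i m ⟨k, hk⟩
    by_cases hij : j = i
    · subst hij
      exact ⟨k + 1, by rw [pow_succ, mul_smul, ← mul_smul (dEl K n j), d_int, one_smul, hk]⟩
    · exact ⟨k, by
        rw [← mul_smul, ((comm_di hij).pow_left k).eq, mul_smul, hk, smul_zero]⟩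
  have hH : ∀ (i : Fin n), ∀ m ∈ Tsub (K := K) M j, HEl K n i • m ∈ Tsub (K := K) M j := by
    rintro i m ⟨k, hk⟩
    by_cases hij : j = i
    · subst hij
      exact ⟨k, by rw [← mul_smul, ← H_dpow, mul_smul, hk, smul_zero]⟩
    · exact ⟨k, by
        rw [← mul_smul, ((comm_dH hij).pow_left k).eq, mul_smul, hk, smul_zero]⟩
  refine stable_of_gen (Tsub (K := K) M j) ?_ ?_ hi a
  · intro i m hm
    rw [x_eq, mul_smul]
    exact hi i _ (hH i _ hm)
  · rintro i m ⟨k, hk⟩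
    exact ⟨k, by rw [← mul_smul, ((comm_dd j i).pow_left k).eq, mul_smul, hk, smul_zero]⟩

/-- the d-torsion, as a submodule -/
def TsubI (M : Type*) [AddCommGroup M] [Module K M]
    [Module (In K n) M] [IsScalarTower K (In K n) M] (j : Fin n) : Submodule (In K n) M where
  carrier := Tsub (K := K) M j
  add_mem' := (Tsub (K := K) M j).add_mem
  zero_mem' := (Tsub (K := K) M j).zero_mem
  smul_mem' := fun a m hm => Tsub_stable j a m hm

lemma shift_mem {mu : Fin n → K} {v : M} (hv : v ∈ weightSpace K n M mu) (j : Fin n) (z : ℤ) :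
    gEl K n j z • v ∈ weightSpace K n M (Function.update mu j (mu j + z)) := by
  intro i
  by_cases hij : i = j
  · subst hij
    rw [Function.update_self, ← mul_smul, H_g, mul_smul, add_smul, hv i, cast_smul_M, ← add_smul,
      smul_sm]
  · rw [Function.update_of_ne hij, ← mul_smul, (comm_Hg hij z).eq, mul_smul, hv i, smul_sm]

lemma gEl_neg (j : Fin n) (k : ℕ) : gEl K n j (-(k : ℤ)) = dEl K n j ^ k := by
  unfold gEl
  split_ifs with h
  · have : k = 0 := by omega
    subst this; simp
  · simp

lemma iSup_gen_top (hg : IsGenWeightModule K n M) : ⨆ mu, genWeightSpace K n M mu = ⊤ := by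
  letI := Classical.decEq (Fin n → K)
  unfold IsGenWeightModule at hg
  exact DirectSum.IsInternal.submodule_iSup_eq_top hg

theorem classify (lam : Fin n → K) (hs : IsSimpleModule (In K n) M)
    (hg : IsGenWeightModule K n M) (hsupp : supp K n M ⊆ orbitOf K n lam) :
    ∃ D ⊆ DD K n lam, ∃ b, IsLat lam D M b := by
  classical
  have : Nontrivial M := IsSimpleModule.nontrivial (In K n) M
  have hgen : ∀ v : M, v ≠ 0 → ∀ N : Submodule (In K n) M, v ∈ N → N = ⊤ := by
    intro v hv N hvN
    rcases eq_bot_or_eq_top N with h | h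
    · rw [h] at hvN; exact absurd hvN hv
    · exact h
  obtain ⟨mu0, v0, hv0, hvm0⟩ : ∃ mu, ∃ v : M, v ≠ 0 ∧ v ∈ weightSpace K n M mu := by
    by_contra hcon
    push Not at hcon
    have h1 : ∀ mu, genWeightSpace K n M mu = ⊥ := by
      intro mu
      rw [Submodule.eq_bot_iff]
      intro m hm
      by_contra hm0
      obtain ⟨v, hv, hvm⟩ := exists_eig hm0 hm
      exact hcon mu v hv hvm
    have h2 : ⨆ mu, genWeightSpace K n M mu = ⊤ :=
      iSup_gen_top hg
    simp only [h1, iSup_bot] at h2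
    exact bot_ne_top h2
  let D : Set (Fin n) := {j | TsubI (K := K) M j = ⊤}
  have hDtop : ∀ j ∈ D, ∀ m : M, ∃ k : ℕ, dEl K n j ^ k • m = 0 := by
    intro j hj m
    have : m ∈ TsubI (K := K) M j := by rw [show TsubI (K := K) M j = ⊤ from hj]; trivial
    exact this
  have hDinj : ∀ j ∉ D, ∀ m : M, dEl K n j • m = 0 → m = 0 := by
    intro j hj m hm
    by_contra h0
    exact hj (hgen m h0 _ (show m ∈ Tsub (K := K) M j from ⟨1, by rwa [pow_one]⟩))
  have hN : ∀ i ∉ D, ∀ m : M, intEl K n i • dEl K n i • m = m := by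
    intro i hi m
    rw [← sub_eq_zero]
    apply hDinj i hi
    rw [smul_sub, ← mul_smul, d_int, one_smul, sub_self]
  have hintinj : ∀ j, ∀ m : M, intEl K n j • m = 0 → m = 0 := by
    intro j m hm
    rw [← one_smul (In K n) m, ← d_int j, mul_smul, hm, smul_zero]
  have hpow : ∀ (a : In K n), (∀ m : M, a • m = 0 → m = 0) → ∀ (k : ℕ) (m : M),
      a ^ k • m = 0 → m = 0 := by
    intro a ha k
    induction k with
    | zero => intro m hm; simpa using hm
    | succ k ih => intro m hm; rw [pow_succ', mul_smul] at hm; exact ih m (ha _ hm)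
  have hginj : ∀ j ∉ D, ∀ (z : ℤ) (m : M), gEl K n j z • m = 0 → m = 0 := by
    intro j hj z m hm
    unfold gEl at hm
    split_ifs at hm
    · exact hpow _ (hintinj j) _ m hm
    · exact hpow _ (hDinj j hj) _ m hm
  have horb : ∀ (mu : Fin n → K) (v : M), v ≠ 0 → v ∈ weightSpace K n M mu →
      mu ∈ orbitOf K n lam := by
    intro mu v hv hvm
    apply hsupp
    intro h
    have := weight_le_gen M mu hvm
    rw [h] at this
    exact hv this
  have key : ∀ s : Finset (Fin n), ∃ (mu : Fin n → K) (v : M), v ≠ 0 ∧ v ∈ weightSpace K n M mu ∧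
      (∀ j ∈ s, j ∈ D → dEl K n j • v = 0) ∧ (∀ j ∈ s, j ∉ D → mu j = lam j) := by
    intro s
    induction s using Finset.induction_on with
    | empty => exact ⟨mu0, v0, hv0, hvm0, by simp, by simp⟩
    | insert j s hj ih =>
      obtain ⟨mu, v, hv, hvm, h1, h2⟩ := ih
      obtain ⟨z, hz0, hzD, hzN⟩ : ∃ z : ℤ, gEl K n j z • v ≠ 0 ∧
          (j ∈ D → dEl K n j • gEl K n j z • v = 0) ∧ (j ∉ D → mu j + z = lam j) := by
        by_cases hjD : j ∈ D
        · obtain ⟨k, hk, hk'⟩ := exists_last hv (hDtop j hjD v)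
          refine ⟨-(k : ℤ), ?_, fun _ => ?_, fun h => absurd hjD h⟩
          · rwa [gEl_neg]
          · rwa [gEl_neg]
        · obtain ⟨z, hz⟩ := horb mu v hv hvm j
          refine ⟨-z, fun h => hv (hginj j hjD _ _ h), fun h => absurd h hjD, fun _ => ?_⟩
          push_cast
          linear_combination hz
      refine ⟨_, _, hz0, shift_mem hvm j z, fun i hi hiD => ?_, fun i hi hiD => ?_⟩
      · rcases Finset.mem_insert.mp hi with rfl | hi'
        · exact hzD hiD
        · have hij : i ≠ j := by rintro rfl; exact hj hi'
          rw [← mul_smul, (comm_dg hij z).eq, mul_smul, h1 i hi' hiD, smul_zero]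
      · rcases Finset.mem_insert.mp hi with rfl | hi'
        · rw [Function.update_self, hzN hiD]
        · have hij : i ≠ j := by rintro rfl; exact hj hi'
          rw [Function.update_of_ne hij, h2 i hi' hiD]
  obtain ⟨mu, v, hv, hvm, h1, h2⟩ := key Finset.univ
  have hd : ∀ i ∈ D, dEl K n i • v = 0 := fun i hi => h1 i (Finset.mem_univ i) hi
  have hH1 : ∀ i ∈ D, HEl K n i • v = v := by
    intro i hi
    have := congrArg (fun a : In K n => a • v) (H_e (K := K) i)
    simp only [mul_smul, sub_smul, one_smul, hd i hi, smul_zero, sub_zero] at this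
    exact this
  refine ⟨D, ?_, _, buildLat lam D v hv hd ?_ hN (hgen v hv)⟩
  · intro i hi
    have e1 := hvm i
    rw [hH1 i hi] at e1
    have e2 : mu i = 1 := by
      have e3 : (1 - mu i) • v = 0 := by rw [sub_smul, one_smul, ← e1, sub_self]
      rcases smul_eq_zero.mp e3 with h | h
      · exact (sub_eq_zero.mp h).symm
      · exact absurd h hv
    obtain ⟨z, hz⟩ := horb mu v hv hvm i
    refine ⟨1 - z, ?_⟩
    push_cast
    rw [e2] at hz
    linear_combination -hz
  · intro i
    by_cases hi : i ∈ D
    · rw [cW, if_pos hi, one_smul, hH1 i hi]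
    · rw [cW, if_neg hi, hvm i, h2 i (Finset.mem_univ i) hi]

end Classif

/-- for an orbit `Ω` (with normalized representative `λ`), the modules `M(𝒟_Ω)`,
`𝒟_Ω ⊆ 𝔻_Ω`, are exactly the simple (generalized) weight modules with support in `Ω`, are
pairwise non-isomorphic (so there are `2^|𝔻_Ω|` of them), `M(𝒟_Ω)` is faithful iff
`𝒟_Ω = {1,…,n}`, otherwise its annihilator is `𝔞_n(𝒩_Ω)`, and they are determined by their
annihilators. -/
theorem statement6 (K : Type*) [Field K] [CharZero K] (n : ℕ)
    (lam : Fin n → K) (hnorm : IsNormalized K n lam) :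
    (∀ D ⊆ DD K n lam, ∀ (M : Type*) [AddCommGroup M] [Module K M] [Module (In K n) M] [IsScalarTower K (In K n) M],
      RealizesMD K n lam D M →
      IsSimpleModule (In K n) M ∧ IsWeightModule K n M ∧ IsGenWeightModule K n M ∧
        supp K n M ⊆ orbitOf K n lam) ∧
    (∀ (M : Type*) [AddCommGroup M] [Module K M] [Module (In K n) M] [IsScalarTower K (In K n) M],
      IsSimpleModule (In K n) M → IsGenWeightModule K n M →
      supp K n M ⊆ orbitOf K n lam → ∃ D ⊆ DD K n lam, RealizesMD K n lam D M) ∧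
    (∀ D ⊆ DD K n lam, ∀ D' ⊆ DD K n lam, ∀ (M M' : Type*) [AddCommGroup M] [Module K M] [Module (In K n) M] [IsScalarTower K (In K n) M] [AddCommGroup M'] [Module K M'] [Module (In K n) M'] [IsScalarTower K (In K n) M'],
      RealizesMD K n lam D M → RealizesMD K n lam D' M' →
      Nonempty (M ≃ₗ[In K n] M') → D = D') ∧
    (∀ D ⊆ DD K n lam, ∀ (M : Type*) [AddCommGroup M] [Module K M] [Module (In K n) M] [IsScalarTower K (In K n) M],
      RealizesMD K n lam D M → (annSet K n M = {0} ↔ D = Set.univ)) ∧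
    (∀ D ⊆ DD K n lam, ∀ (M : Type*) [AddCommGroup M] [Module K M] [Module (In K n) M] [IsScalarTower K (In K n) M],
      RealizesMD K n lam D M → D ≠ Set.univ →
      annSet K n M = (aIdeal K n Dᶜ : Set (In K n))) ∧
    (∀ D ⊆ DD K n lam, ∀ D' ⊆ DD K n lam, ∀ (M M' : Type*) [AddCommGroup M] [Module K M] [Module (In K n) M] [IsScalarTower K (In K n) M] [AddCommGroup M'] [Module K M'] [Module (In K n) M'] [IsScalarTower K (In K n) M'],
      RealizesMD K n lam D M → RealizesMD K n lam D' M' →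
      annSet K n M = annSet K n M' → D = D') := by
  refine ⟨?_, ?_, ?_, ?_, ?_, ?_⟩
  · intro D hD M _ _ _ _ hM
    obtain ⟨b, h⟩ := lat_of_MD hM
    exact ⟨h.simple, h.isWeight, h.isGenWeight, h.supp_sub hnorm hD⟩
  · intro M _ _ _ _ hs hg hsupp
    obtain ⟨D, hD, b, h⟩ := classify lam hs hg hsupp
    exact ⟨D, hD, MD_of_lat h⟩
  · intro D _ D' _ M M' _ _ _ _ _ _ _ _ hM hM' he
    obtain ⟨e⟩ := he
    obtain ⟨b, h⟩ := lat_of_MD hM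
    obtain ⟨b', h'⟩ := lat_of_MD hM'
    rw [h.D_eq, h'.D_eq, annSet_iso e]
  · intro D _ M _ _ _ _ hM
    obtain ⟨b, h⟩ := lat_of_MD hM
    exact h.faithful
  · intro D _ M _ _ _ _ hM _
    obtain ⟨b, h⟩ := lat_of_MD hM
    exact h.ann
  · intro D _ D' _ M M' _ _ _ _ _ _ _ _ hM hM' he
    obtain ⟨b, h⟩ := lat_of_MD hM
    obtain ⟨b', h'⟩ := lat_of_MD hM'
    rw [h.D_eq, h'.D_eq, he]

end IDO
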